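/- Let G be a bounded connected component of {E : ℝ | k(E)² > 4} lying in the classically allowed region for the defect, i.e. E > q_def(x) for every E in the closure of G and every x ∈ [0,1]. Let n_G ∈ ℕ∞ be the number of connected components of the set R_def ∩ G, and let n_∂G be the number of elements of (closure(G) \ G) ∩ R_def. Then the extended cardinality D of the set {E ∈ G | E is a defect eigenvalue} satisfies n_G + 1 − n_∂G ≤ D ≤ n_G + 1 (inequalities in ℕ∞, with truncated subtraction). -/

import Mathlib

open Matrix MeasureTheory

/-- A set `S ⊆ ℝ` is locally finite if every point has a neighborhood meeting `S` in a
finite set. -/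
def LocallyFiniteSet (S : Set ℝ) : Prop :=
  ∀ x : ℝ, ∃ U ∈ nhds x, (S ∩ U).Finite

/-- A function is piecewise continuous if it is continuous off a locally finite set. -/
def PiecewiseContinuous (f : ℝ → ℝ) : Prop :=
  ∃ S : Set ℝ, LocallyFiniteSet S ∧ ContinuousOn f Sᶜ

/-- `W` is the fundamental solution matrix of `-u'' + p u = E u`, i.e. the continuous
solution of `W x = 1 + ∫₀ˣ !![0, 1; p s - E, 0] * W s ds` (read entrywise). -/
def IsFundamentalSolution (p : ℝ → ℝ) (E : ℝ)
    (W : ℝ → Matrix (Fin 2) (Fin 2) ℝ) : Prop :=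
  (∀ i j, Continuous fun x => W x i j) ∧
    ∀ (x : ℝ) (i j : Fin 2), W x i j =
      (1 : Matrix (Fin 2) (Fin 2) ℝ) i j +
        ∫ s in (0:ℝ)..x, (!![0, 1; p s - E, 0] * W s) i j

/-- `E` is a defect eigenvalue for the potential `q`: there is a differentiable,
not identically zero, square-integrable function `u` with
`u' x = u' 0 + ∫₀ˣ (q s - E) u s ds` for all `x` (i.e. `-u'' + q u = E u`). -/
def IsDefectEigenvalue (q : ℝ → ℝ) (E : ℝ) : Prop :=
  ∃ u : ℝ → ℝ, Differentiable ℝ u ∧ u ≠ 0 ∧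
    Integrable (fun x => (u x) ^ 2) ∧
    ∀ x : ℝ, deriv u x = deriv u 0 + ∫ s in (0:ℝ)..x, (q s - E) * u s

/-- `G` is a gap of the Floquet discriminant `k`: a bounded connected component of
`{E | k E ^ 2 > 4}`. -/
def IsGap (k : ℝ → ℝ) (G : Set ℝ) : Prop :=
  Bornology.IsBounded G ∧
    ∃ E ∈ {E : ℝ | k E ^ 2 > 4}, G = connectedComponentIn {E : ℝ | k E ^ 2 > 4} E

/-- For `a : ℝ`, `Fset a` is the set of `y : ℝ` such that for every `δ > 0` there are
infinitely many pairs of integers `(N, M)` with `M ≥ 1` and `|y - M * (N - M * a)| < δ`. -/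
def Fset (a : ℝ) : Set ℝ :=
  {y | ∀ δ > 0,
    {p : ℤ × ℤ | 1 ≤ p.2 ∧ |y - (p.2 : ℝ) * ((p.1 : ℝ) - (p.2 : ℝ) * a)| < δ}.Infinite}

section AngleLifts

open Real Set Filter Topology

/-- `θ` is a continuous lift of the action of the matrices `A E ∈ SL(2, ℝ)` on directions, where the
direction `φ` is that of the vector `(sin φ, cos φ)`; it is increasing in the energy. -/
structure AngleLift (A : ℝ → Matrix (Fin 2) (Fin 2) ℝ) (θ : ℝ → ℝ → ℝ) : Prop where
  det_eq_one : ∀ E, A E 0 0 * A E 1 1 - A E 0 1 * A E 1 0 = 1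
  cont : Continuous fun z : ℝ × ℝ => θ z.1 z.2
  spec : ∀ E φ, ∃ r ≠ 0, A E 0 0 * sin φ + A E 0 1 * cos φ = r * sin (θ E φ) ∧
    A E 1 0 * sin φ + A E 1 1 * cos φ = r * cos (θ E φ)
  add_pi : ∀ E φ, θ E (φ + π) = θ E φ + π
  mono_angle : ∀ E, StrictMono (θ E)
  mono_energy : ∀ φ, StrictMono fun E => θ E φ

/-- `(sin φ, cos φ)` is an eigenvector of `B` with eigenvalue `c`. -/
def IsEigenAngle (B : Matrix (Fin 2) (Fin 2) ℝ) (c φ : ℝ) : Prop :=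
  B 0 0 * sin φ + B 0 1 * cos φ = c * sin φ ∧ B 1 0 * sin φ + B 1 1 * cos φ = c * cos φ

theorem IsEigenAngle.four_le_trace_sq {B : Matrix (Fin 2) (Fin 2) ℝ} {c φ : ℝ}
    (h : IsEigenAngle B c φ) (hB : B 0 0 * B 1 1 - B 0 1 * B 1 0 = 1) : 4 ≤ B.trace ^ 2 := by
  obtain ⟨h1, h2⟩ := h
  have hs := sin_sq_add_cos_sq φ
  have hc : c ^ 2 - (B 0 0 + B 1 1) * c + 1 = 0 := by
    have e1 : ((B 0 0 - c) * (B 1 1 - c) - B 0 1 * B 1 0) * sin φ = 0 := by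
      linear_combination (B 1 1 - c) * h1 - B 0 1 * h2
    have e2 : ((B 0 0 - c) * (B 1 1 - c) - B 0 1 * B 1 0) * cos φ = 0 := by
      linear_combination (B 0 0 - c) * h2 - B 1 0 * h1
    linear_combination sin φ * e1 + cos φ * e2 - hB -
      ((B 0 0 - c) * (B 1 1 - c) - B 0 1 * B 1 0) * hs
  rw [Matrix.trace_fin_two]
  nlinarith [sq_nonneg (2 * c - (B 0 0 + B 1 1))]

theorem IsEigenAngle.mul_eq_one {B : Matrix (Fin 2) (Fin 2) ℝ} {c d φ ψ : ℝ}
    (h : IsEigenAngle B c φ) (h' : IsEigenAngle B d ψ)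
    (hB : B 0 0 * B 1 1 - B 0 1 * B 1 0 = 1) (hs : sin (ψ - φ) ≠ 0) : c * d = 1 := by
  obtain ⟨h1, h2⟩ := h
  obtain ⟨h3, h4⟩ := h'
  rw [sin_sub] at hs
  have key : (c * d - 1) * (sin ψ * cos φ - cos ψ * sin φ) = 0 := by
    linear_combination (-(B 1 0 * sin φ + B 1 1 * cos φ)) * h3 +
      (B 1 0 * sin ψ + B 1 1 * cos ψ) * h1 + c * sin φ * h4 - d * sin ψ * h2 +
      (sin ψ * cos φ - cos ψ * sin φ) * hB
  have := (mul_eq_zero.1 key).resolve_right hs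
  linarith

theorem IsEigenAngle.trace_eq {B : Matrix (Fin 2) (Fin 2) ℝ} {c d φ ψ : ℝ}
    (h : IsEigenAngle B c φ) (h' : IsEigenAngle B d ψ) (hs : sin (ψ - φ) ≠ 0) :
    B.trace = c + d := by
  obtain ⟨h1, h2⟩ := h
  obtain ⟨h3, h4⟩ := h'
  rw [sin_sub] at hs
  rw [Matrix.trace_fin_two]
  have key : (B 0 0 + B 1 1 - (c + d)) * (sin ψ * cos φ - cos ψ * sin φ) = 0 := by
    linear_combination sin ψ * h2 - cos ψ * h1 + cos φ * h3 - sin φ * h4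
  have := (mul_eq_zero.1 key).resolve_right hs
  linarith

theorem exists_sin_cos_of_trace_sq {B : Matrix (Fin 2) (Fin 2) ℝ}
    (hB : B 0 0 * B 1 1 - B 0 1 * B 1 0 = 1) (h : 4 ≤ B.trace ^ 2) :
    ∃ φ, (B 0 0 * sin φ + B 0 1 * cos φ) * cos φ = (B 1 0 * sin φ + B 1 1 * cos φ) * sin φ := by
  rw [Matrix.trace_fin_two] at h
  by_cases hc : B 1 0 = 0
  · exact ⟨π / 2, by simp [hc]⟩
  · set Δ : ℝ := (B 0 0 + B 1 1) ^ 2 - 4 with hΔ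
    have hsq : √Δ ^ 2 = Δ := sq_sqrt (by linarith)
    set z : ℂ := ⟨2 * B 1 0, B 0 0 - B 1 1 + √Δ⟩ with hz
    have hz0 : z ≠ 0 := fun h0 => hc (by simpa [hz] using congrArg Complex.re h0)
    refine ⟨z.arg, ?_⟩
    rw [Complex.sin_arg, Complex.cos_arg hz0]
    have hn : ‖z‖ ≠ 0 := norm_ne_zero_iff.2 hz0
    have hre : z.re = 2 * B 1 0 := rfl
    have him : z.im = B 0 0 - B 1 1 + √Δ := rfl
    field_simp
    rw [hre, him]
    linear_combination (-B 1 0) * hsq - B 1 0 * hΔ - 4 * B 1 0 * hB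

namespace AngleLift

variable {A : ℝ → Matrix (Fin 2) (Fin 2) ℝ} {θ : ℝ → ℝ → ℝ} (h : AngleLift A θ)
include h

theorem cont_angle (E : ℝ) : Continuous (θ E) :=
  h.cont.comp (Continuous.prodMk continuous_const continuous_id)

theorem cont_energy (φ : ℝ) : Continuous fun E => θ E φ :=
  h.cont.comp (Continuous.prodMk continuous_id continuous_const)

theorem add_nat_mul_pi (E φ : ℝ) (n : ℕ) : θ E (φ + n * π) = θ E φ + n * π := by
  induction n with
  | zero => simp
  | succ n ih =>
    rw [show φ + ((n + 1 : ℕ) : ℝ) * π = (φ + n * π) + π by push_cast; ring, h.add_pi, ih]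
    push_cast; ring

theorem add_int_mul_pi (E φ : ℝ) (n : ℤ) : θ E (φ + n * π) = θ E φ + n * π := by
  obtain ⟨m, rfl | rfl⟩ := n.eq_nat_or_neg
  · simpa using h.add_nat_mul_pi E φ m
  · have := h.add_nat_mul_pi E (φ + ((-m : ℤ) : ℝ) * π) m
    push_cast at this ⊢
    rw [show φ + -(m : ℝ) * π + m * π = φ by ring] at this
    linarith

theorem sub_int_mul_pi (m : ℤ) : AngleLift A fun E φ => θ E φ - m * π where
  det_eq_one := h.det_eq_one
  cont := h.cont.sub continuous_const
  spec E φ := by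
    obtain ⟨r, hr, h1, h2⟩ := h.spec E φ
    refine ⟨r * (-1) ^ m, mul_ne_zero hr (zpow_ne_zero _ (by norm_num)), ?_, ?_⟩
    · rw [h1, sin_sub_int_mul_pi, mul_assoc, ← mul_assoc ((-1 : ℝ) ^ m), ← mul_zpow]; simp
    · rw [h2, cos_sub_int_mul_pi, mul_assoc, ← mul_assoc ((-1 : ℝ) ^ m), ← mul_zpow]; simp
  add_pi E φ := by rw [h.add_pi]; ring
  mono_angle E := fun x y hxy => by simpa using h.mono_angle E hxy
  mono_energy φ := fun x y hxy => by simpa using h.mono_energy φ hxy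

theorem reflect : AngleLift (fun E => !![A (-E) 0 0, -A (-E) 0 1; -A (-E) 1 0, A (-E) 1 1])
    fun E φ => -θ (-E) (-φ) where
  det_eq_one E := by simpa using h.det_eq_one (-E)
  cont := (h.cont.comp (continuous_neg.prodMap continuous_neg)).neg
  spec E φ := by
    obtain ⟨r, hr, h1, h2⟩ := h.spec (-E) (-φ)
    refine ⟨r, hr, ?_, ?_⟩
    · simp only [sin_neg, cos_neg] at h1 ⊢
      simp
      linarith
    · simp only [sin_neg, cos_neg] at h2 ⊢
      simp
      linarith
  add_pi E φ := by
    have := h.add_pi (-E) (-(φ + π))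
    rw [show -(φ + π) + π = -φ by ring] at this
    linarith
  mono_angle E := fun x y hxy => neg_lt_neg (h.mono_angle _ (neg_lt_neg hxy))
  mono_energy φ := fun x y hxy => neg_lt_neg (h.mono_energy _ (neg_lt_neg hxy))

theorem isEigenAngle {E φ : ℝ} (hφ : sin (θ E φ - φ) = 0) : ∃ c, IsEigenAngle (A E) c φ := by
  obtain ⟨r, -, h1, h2⟩ := h.spec E φ
  refine ⟨r * cos (θ E φ - φ), ?_, ?_⟩
  · rw [h1, show r * sin (θ E φ) = r * sin (φ + (θ E φ - φ)) by ring_nf, sin_add, hφ]; ring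
  · rw [h2, show r * cos (θ E φ) = r * cos (φ + (θ E φ - φ)) by ring_nf, cos_add, hφ]; ring

theorem int_unique {E φ ψ : ℝ} {i j : ℤ} (hi : θ E φ = φ + i * π) (hj : θ E ψ = ψ + j * π) :
    i = j := by
  wlog hij : i < j generalizing φ ψ i j with H
  · rcases lt_trichotomy i j with hlt | heq | hgt
    · exact H hi hj hlt
    · exact heq
    · exact (H hj hi hgt).symm
  exfalso
  obtain ⟨n, hn, -⟩ := existsUnique_add_zsmul_mem_Ioc pi_pos ψ (φ - π)
  rw [zsmul_eq_mul, sub_add_cancel] at hn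
  have h1 := (h.mono_angle E).monotone hn.2
  rw [h.add_int_mul_pi, hi, hj] at h1
  have : ((i : ℝ) + 1) * π ≤ j * π := by
    apply mul_le_mul_of_nonneg_right _ pi_pos.le
    exact_mod_cast hij
  linarith [hn.1]

theorem four_le_trace_sq_iff (E : ℝ) :
    4 ≤ (A E).trace ^ 2 ↔ ∃ φ, ∃ j : ℤ, θ E φ = φ + j * π := by
  constructor
  · intro ht
    obtain ⟨φ, hφ⟩ := exists_sin_cos_of_trace_sq (h.det_eq_one E) ht
    obtain ⟨r, hr, h1, h2⟩ := h.spec E φ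
    rw [h1, h2] at hφ
    have h0 : sin (θ E φ - φ) = 0 := by
      have : r * sin (θ E φ - φ) = 0 := by rw [sin_sub]; linarith
      exact (mul_eq_zero.1 this).resolve_left hr
    obtain ⟨j, hj⟩ := sin_eq_zero_iff.1 h0
    exact ⟨φ, j, by linarith⟩
  · rintro ⟨φ, j, hj⟩
    obtain ⟨c, hc⟩ := h.isEigenAngle (E := E) (φ := φ) (by rw [hj]; simp)
    exact hc.four_le_trace_sq (h.det_eq_one E)

theorem exists_mem_Icc (E φ : ℝ) : ∃ ψ ∈ Icc 0 π, θ E ψ - ψ = θ E φ - φ := by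
  obtain ⟨n, hn, -⟩ := existsUnique_add_zsmul_mem_Ico pi_pos φ 0
  rw [zsmul_eq_mul, zero_add] at hn
  exact ⟨_, Ico_subset_Icc_self hn, by rw [h.add_int_mul_pi]; ring⟩

theorem exists_mem_Ico (E φ a : ℝ) : ∃ ψ ∈ Ico a (a + π), θ E ψ - ψ = θ E φ - φ := by
  obtain ⟨n, hn, -⟩ := existsUnique_add_zsmul_mem_Ico pi_pos φ a
  rw [zsmul_eq_mul] at hn
  exact ⟨_, hn, by rw [h.add_int_mul_pi]; ring⟩

theorem lt_add_one_mul_pi {E φ : ℝ} {j : ℤ} (hj : θ E φ = φ + j * π) (ψ : ℝ) :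
    θ E ψ - ψ < (j + 1) * π := by
  obtain ⟨χ, hχ, hd⟩ := h.exists_mem_Ico E ψ (φ - π)
  rw [← hd]
  rw [sub_add_cancel] at hχ
  have := h.mono_angle E hχ.2
  linarith [hχ.1]

theorem exists_eq_of_le_of_le {E φ ψ c : ℝ} (h1 : θ E φ - φ ≤ c) (h2 : c ≤ θ E ψ - ψ) :
    ∃ χ, θ E χ = χ + c := by
  obtain ⟨χ, hχ⟩ := mem_range_of_exists_le_of_exists_ge
    ((h.cont_angle E).sub continuous_id) ⟨φ, h1⟩ ⟨ψ, h2⟩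
  exact ⟨χ, by simp at hχ; linarith⟩

theorem eventually_trace_sq_lt {E φ : ℝ} {j : ℤ} (hj : θ E φ = φ + j * π)
    (hle : ∀ ψ, j * π ≤ θ E ψ - ψ) : ∀ᶠ E' in 𝓝[>] E, (A E').trace ^ 2 < 4 := by
  have hev : ∀ᶠ E' in 𝓝 E, ∀ ψ ∈ Icc 0 π, θ E' ψ - ψ < (j + 1) * π := by
    refine isCompact_Icc.eventually_forall_of_forall_eventually fun ψ _ => ?_
    have hc : Continuous fun z : ℝ × ℝ => θ z.1 z.2 - z.2 := h.cont.sub continuous_snd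
    exact hc.continuousAt.eventually_lt continuousAt_const (h.lt_add_one_mul_pi hj ψ)
  filter_upwards [nhdsWithin_le_nhds hev, self_mem_nhdsWithin] with E' hE' hlt
  by_contra! hcon
  obtain ⟨ψ, i, hi⟩ := (h.four_le_trace_sq_iff E').1 hcon
  obtain ⟨χ, hχ, hd⟩ := h.exists_mem_Icc E' ψ
  have h1 := hE' χ hχ
  have h2 := h.mono_energy χ hlt
  have h3 := hle χ
  simp only at h2
  have h4 : (i : ℝ) * π < (j + 1) * π := by linarith
  have h5 : (j : ℝ) * π < i * π := by linarith
  have h4' : i < j + 1 := by exact_mod_cast lt_of_mul_lt_mul_right h4 pi_pos.le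
  have h5' : j < i := by exact_mod_cast lt_of_mul_lt_mul_right h5 pi_pos.le
  omega

theorem int_eq_of_Icc {E E' φ ψ : ℝ} {i j : ℤ} (hEE' : E ≤ E')
    (hR : ∀ x ∈ Icc E E', 4 ≤ (A x).trace ^ 2)
    (hi : θ E φ = φ + i * π) (hj : θ E' ψ = ψ + j * π) : i = j := by
  set K : Set (ℝ × ℝ) := (Icc E E' ×ˢ Icc 0 π) ∩ {z | θ z.1 z.2 - z.2 ≤ i * π} with hK
  have hKc : IsCompact K := (isCompact_Icc.prod isCompact_Icc).inter_right
    (isClosed_le (h.cont.sub continuous_snd) continuous_const)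
  have hS : IsCompact (Prod.fst '' K) := hKc.image continuous_fst
  have hmem : ∀ {x χ}, x ∈ Icc E E' → θ x χ - χ ≤ i * π → x ∈ Prod.fst '' K := by
    intro x χ hx hχ
    obtain ⟨χ', hχ', hd⟩ := h.exists_mem_Icc x χ
    exact ⟨(x, χ'), ⟨⟨hx, hχ'⟩, by rw [mem_ofPred_eq]; linarith⟩, rfl⟩
  have hne : (Prod.fst '' K).Nonempty := ⟨E, hmem (left_mem_Icc.2 hEE') (by rw [hi]; simp)⟩
  obtain ⟨⟨x, χ⟩, ⟨⟨hx, hχ⟩, hle⟩, hxe⟩ := hS.sSup_mem hne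
  change x = _ at hxe
  change x ∈ _ at hx
  change θ x χ - χ ≤ _ at hle
  have hup : ∀ y, x < y → y ≤ E' → ∀ χ, i * π < θ y χ - χ := by
    intro y hxy hy χ
    by_contra! hcon
    have := le_csSup hS.bddAbove (hmem ⟨hx.1.trans hxy.le, hy⟩ hcon)
    linarith
  obtain ⟨χ₀, hχ₀⟩ : ∃ χ₀, θ x χ₀ = χ₀ + i * π := by
    refine h.exists_eq_of_le_of_le hle (ψ := φ) ?_
    have := (h.mono_energy φ).monotone hx.1
    linarith
  rcases hx.2.eq_or_lt with heq | hlt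
  · rw [heq] at hχ₀
    exact h.int_unique hχ₀ hj
  · exfalso
    have hev := h.eventually_trace_sq_lt hχ₀ (fun χ => by
      have ht : Tendsto (fun y => θ y χ - χ) (𝓝[>] x) (𝓝 (θ x χ - χ)) :=
        (((h.cont_energy χ).sub continuous_const).tendsto x).mono_left nhdsWithin_le_nhds
      refine ge_of_tendsto ht ?_
      filter_upwards [Ioc_mem_nhdsGT hlt] with y hy
      exact (hup y hy.1 hy.2 χ).le)
    obtain ⟨y, hy1, hy2⟩ := (hev.and (Ioc_mem_nhdsGT hlt)).exists
    have := hR y ⟨hx.1.trans hy2.1.le, hy2.2⟩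
    linarith

theorem int_eq_of_isPreconnected {C : Set ℝ} (hC : IsPreconnected C)
    (hR : ∀ x ∈ C, 4 ≤ (A x).trace ^ 2) {E E' φ ψ : ℝ} {i j : ℤ} (hE : E ∈ C) (hE' : E' ∈ C)
    (hi : θ E φ = φ + i * π) (hj : θ E' ψ = ψ + j * π) : i = j := by
  rcases le_total E E' with hle | hle
  · exact h.int_eq_of_Icc hle (fun x hx => hR x (hC.ordConnected.out hE hE' hx)) hi hj
  · exact (h.int_eq_of_Icc hle (fun x hx => hR x (hC.ordConnected.out hE' hE hx)) hj hi).symm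

end AngleLift

end AngleLifts

section RotatingFamilies

open Real Set Filter Topology

/-- A continuous family in `SL(2, ℝ)` which, infinitesimally in the energy, rotates the images of
all directions in the positive sense. -/
structure IsRotating (A : ℝ → Matrix (Fin 2) (Fin 2) ℝ) : Prop where
  cont : ∀ i j, Continuous fun E => A E i j
  det_eq_one : ∀ E, A E 0 0 * A E 1 1 - A E 0 1 * A E 1 0 = 1
  rotates : ∀ E φ, ∀ᶠ E' in 𝓝[>] E,
    0 < (A E' 0 0 * sin φ + A E' 0 1 * cos φ) * (A E 1 0 * sin φ + A E 1 1 * cos φ) -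
      (A E' 1 0 * sin φ + A E' 1 1 * cos φ) * (A E 0 0 * sin φ + A E 0 1 * cos φ)

theorem strictMono_of_eventually_lt {f : ℝ → ℝ} (hf : Continuous f)
    (h : ∀ x, ∀ᶠ y in 𝓝[>] x, f x < f y) : StrictMono f := by
  intro x y hxy
  obtain ⟨m, hm, hmax⟩ := isCompact_Icc.exists_isMaxOn (nonempty_Icc.2 hxy.le) hf.continuousOn
  have hmy : ∀ z ∈ Icc x y, z < y → ∃ w ∈ Icc x y, f z < f w := by
    intro z hz hzy
    obtain ⟨w, hw, hwm⟩ := ((h z).and (Ioo_mem_nhdsGT hzy)).exists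
    exact ⟨w, ⟨hz.1.trans hwm.1.le, hwm.2.le⟩, hw⟩
  have hle : ∀ z ∈ Icc x y, f z ≤ f m := fun z hz => hmax hz
  rcases hm.2.eq_or_lt with rfl | hlt
  · obtain ⟨w, hw, hxw⟩ := hmy x (left_mem_Icc.2 hxy.le) hxy
    exact hxw.trans_le (hle w hw)
  · obtain ⟨w, hw, hmw⟩ := hmy m hm hlt
    linarith [hle w hw]

theorem abs_lt_pi_of_sin_ne_zero {f : ℝ → ℝ} (hf : Continuous f) {s : Set ℝ} (hs : s.OrdConnected)
    {x : ℝ} (hx : x ∈ s) (hfx : |f x| < π) (hne : ∀ y ∈ s, |f y| ≠ π) {y : ℝ} (hy : y ∈ s) :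
    |f y| < π := by
  by_contra! hcon
  obtain ⟨z, hz, he⟩ := hs.isPreconnected.intermediate_value hx hy hf.abs.continuousOn
    (show π ∈ Icc _ _ from ⟨hfx.le, hcon⟩)
  exact hne z hz he

theorem IsRotating.exists_angleLift {A : ℝ → Matrix (Fin 2) (Fin 2) ℝ} (h : IsRotating A) :
    ∃ θ, AngleLift A θ := by
  set g : ℝ × ℝ → ℂ := fun z =>
    ((A z.1 1 0 * sin z.2 + A z.1 1 1 * cos z.2 : ℝ) : ℂ) +
      ((A z.1 0 0 * sin z.2 + A z.1 0 1 * cos z.2 : ℝ) : ℂ) * Complex.I with hg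
  have hgre : ∀ z, (g z).re = A z.1 1 0 * sin z.2 + A z.1 1 1 * cos z.2 := fun z => by
    simp [hg, -Complex.ofReal_add, -Complex.ofReal_mul]
  have hgim : ∀ z, (g z).im = A z.1 0 0 * sin z.2 + A z.1 0 1 * cos z.2 := fun z => by
    simp [hg, -Complex.ofReal_add, -Complex.ofReal_mul]
  have hgc : Continuous g := by
    have hA : ∀ i j, Continuous fun z : ℝ × ℝ => A z.1 i j := fun i j =>
      (h.cont i j).comp continuous_fst
    have h1 := (hA 1 0).mul (continuous_sin.comp continuous_snd)
    have h2 := (hA 1 1).mul (continuous_cos.comp continuous_snd)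
    have h3 := (hA 0 0).mul (continuous_sin.comp continuous_snd)
    have h4 := (hA 0 1).mul (continuous_cos.comp continuous_snd)
    exact (Complex.continuous_ofReal.comp (h1.add h2)).add
      ((Complex.continuous_ofReal.comp (h3.add h4)).mul continuous_const)
  have hg0 : ∀ z, g z ≠ 0 := by
    intro z hz
    have h1 : A z.1 1 0 * sin z.2 + A z.1 1 1 * cos z.2 = 0 := by rw [← hgre, hz]; rfl
    have h2 : A z.1 0 0 * sin z.2 + A z.1 0 1 * cos z.2 = 0 := by rw [← hgim, hz]; rfl
    have hd := h.det_eq_one z.1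
    have hs : sin z.2 = 0 := by linear_combination (-sin z.2) * hd + A z.1 1 1 * h2 - A z.1 0 1 * h1
    have hc : cos z.2 = 0 := by linear_combination (-cos z.2) * hd + A z.1 0 0 * h1 - A z.1 1 0 * h2
    have := sin_sq_add_cos_sq z.2
    rw [hs, hc] at this
    norm_num at this
  have hsc : IsSimplyConnected (univ : Set (ℝ × ℝ)) := by
    have : ContractibleSpace (univ : Set (ℝ × ℝ)) := convex_univ.contractibleSpace univ_nonempty
    exact inferInstanceAs (SimplyConnectedSpace (univ : Set (ℝ × ℝ)))
  obtain ⟨f, hfc, hf⟩ := Complex.exists_continuousOn_eqOn_exp_comp hsc isOpen_univ hgc.continuousOn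
    (by rintro ⟨z, -, hz⟩; exact hg0 z hz)
  rw [continuousOn_univ] at hfc
  have hfg : ∀ z, Complex.exp (f z) = g z := fun z => hf (mem_univ z)
  set θ : ℝ → ℝ → ℝ := fun E φ => (f (E, φ)).im with hθ
  have hθc : Continuous fun z : ℝ × ℝ => θ z.1 z.2 := Complex.continuous_im.comp hfc
  have hspec : ∀ E φ, ∃ r > 0, A E 0 0 * sin φ + A E 0 1 * cos φ = r * sin (θ E φ) ∧
      A E 1 0 * sin φ + A E 1 1 * cos φ = r * cos (θ E φ) := fun E φ => by
    refine ⟨Real.exp (f (E, φ)).re, exp_pos _, ?_, ?_⟩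
    · rw [← hgim (E, φ), ← hfg, Complex.exp_im]
    · rw [← hgre (E, φ), ← hfg, Complex.exp_re]
  have hang : ∀ E φ, Continuous (θ E) ∧ Continuous fun E => θ E φ := fun E φ =>
    ⟨hθc.comp (Continuous.prodMk continuous_const continuous_id),
      hθc.comp (Continuous.prodMk continuous_id continuous_const)⟩
  have hsin : ∀ E φ ψ, ∃ r > 0, sin (ψ - φ) = r * sin (θ E ψ - θ E φ) := fun E φ ψ => by
    obtain ⟨r, hr, h1, h2⟩ := hspec E φ
    obtain ⟨s, hs, h3, h4⟩ := hspec E ψ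
    refine ⟨r * s, mul_pos hr hs, ?_⟩
    rw [sin_sub, sin_sub]
    linear_combination (-(sin ψ * cos φ - cos ψ * sin φ)) * h.det_eq_one E +
      (A E 1 0 * sin φ + A E 1 1 * cos φ) * h3 + s * sin (θ E ψ) * h2 -
      (A E 0 0 * sin φ + A E 0 1 * cos φ) * h4 - s * cos (θ E ψ) * h1
  have hpos : ∀ E φ ψ, ψ ∈ Ioo φ (φ + π) → 0 < sin (θ E ψ - θ E φ) := fun E φ ψ hψ => by
    obtain ⟨r, hr, hrs⟩ := hsin E φ ψ
    have : 0 < sin (ψ - φ) := sin_pos_of_pos_of_lt_pi (by linarith [hψ.1]) (by linarith [hψ.2])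
    rw [hrs] at this
    exact (mul_pos_iff_of_pos_left hr).1 this
  have hdiff : ∀ E φ ψ, ψ ∈ Ioo φ (φ + π) → 0 < θ E ψ - θ E φ ∧ θ E ψ - θ E φ < π := by
    intro E φ ψ hψ
    have hlt : |θ E ψ - θ E φ| < π := by
      refine abs_lt_pi_of_sin_ne_zero (f := fun ψ => θ E ψ - θ E φ)
        ((hang E φ).1.sub continuous_const) (s := Ico φ (φ + π)) ordConnected_Ico (x := φ)
        ⟨le_rfl, by linarith [pi_pos]⟩ (by simp [pi_pos]) ?_ ⟨hψ.1.le, hψ.2⟩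
      intro y hy hcon
      rcases hy.1.eq_or_lt with rfl | hlt
      · simp [pi_ne_zero.symm] at hcon
      · have := hpos E φ y ⟨hlt, hy.2⟩
        rcases (abs_eq pi_pos.le).1 hcon with h1 | h1 <;> simp [h1] at this
    have hp := hpos E φ ψ hψ
    refine ⟨?_, (abs_lt.1 hlt).2⟩
    by_contra! hcon
    linarith [sin_nonpos_of_nonpos_of_neg_pi_le hcon (abs_lt.1 hlt).1.le]
  refine ⟨θ, h.det_eq_one, hθc, fun E φ => ?_, fun E φ => ?_, fun E => ?_, fun φ => ?_⟩
  · obtain ⟨r, hr, h1⟩ := hspec E φ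
    exact ⟨r, hr.ne', h1⟩
  · obtain ⟨r, hr, hrs⟩ := hsin E φ (φ + π)
    have hmem : ∀ᶠ ψ in 𝓝[<] (φ + π), ψ ∈ Ioo φ (φ + π) :=
      Ioo_mem_nhdsLT (by linarith [pi_pos])
    have ht : Tendsto (fun ψ => θ E ψ - θ E φ) (𝓝[<] (φ + π)) (𝓝 (θ E (φ + π) - θ E φ)) :=
      (((hang E φ).1.sub continuous_const).tendsto _).mono_left nhdsWithin_le_nhds
    have h1 : θ E (φ + π) - θ E φ ≤ π :=
      le_of_tendsto ht (hmem.mono fun ψ hψ => (hdiff E φ ψ hψ).2.le)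
    have h2 : 0 < θ E (φ + π) - θ E φ := by
      have i1 := hdiff E φ (φ + π / 2) ⟨by linarith [pi_pos], by linarith [pi_pos]⟩
      have i2 := hdiff E (φ + π / 2) (φ + π) ⟨by linarith [pi_pos], by linarith [pi_pos]⟩
      linarith [i1.1, i2.1]
    rw [show φ + π - φ = π by ring, sin_pi] at hrs
    have h3 : sin (θ E (φ + π) - θ E φ) = 0 := (mul_eq_zero.1 hrs.symm).resolve_left hr.ne'
    rcases h1.eq_or_lt with heq | hlt
    · linarith
    · exact absurd h3 (sin_pos_of_pos_of_lt_pi h2 hlt).ne'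
  · refine strictMono_of_eventually_lt (hang E 0).1 fun φ => ?_
    filter_upwards [Ioo_mem_nhdsGT (show φ < φ + π by linarith [pi_pos])] with ψ hψ
    linarith [(hdiff E φ ψ hψ).1]
  · refine strictMono_of_eventually_lt (hang 0 φ).2 fun E => ?_
    have hev : ∀ᶠ E' in 𝓝[>] E, θ E φ - π < θ E' φ :=
      nhdsWithin_le_nhds (continuousAt_const.eventually_lt (hang 0 φ).2.continuousAt
        (by linarith [pi_pos]))
    filter_upwards [hev, h.rotates E φ] with E' h1 h2
    obtain ⟨r, hr, e1, e2⟩ := hspec E φ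
    obtain ⟨s, hs, e3, e4⟩ := hspec E' φ
    rw [e1, e2, e3, e4] at h2
    have h3 : 0 < (s * r) * sin (θ E' φ - θ E φ) := by rw [sin_sub]; linarith
    have h4 := (mul_pos_iff_of_pos_left (mul_pos hs hr)).1 h3
    by_contra! hcon
    linarith [sin_nonpos_of_nonpos_of_neg_pi_le (sub_nonpos.2 hcon) (by linarith)]

end RotatingFamilies

section GapDirections

open Real Set Filter Topology

theorem exists_zero_sign_change {g : ℝ → ℝ} (hg : Continuous g) {p q : ℝ} (hpq : p < q)
    (hp : 0 < g p) (hq : g q < 0)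
    (huniq : ∀ x ∈ Ioo p q, ∀ y ∈ Ioo p q, g x = 0 → g y = 0 → x = y) :
    ∃ z ∈ Ioo p q, g z = 0 ∧ (∀ x ∈ Ico p z, 0 < g x) ∧ ∀ x ∈ Ioc z q, g x < 0 := by
  obtain ⟨z, hz, hgz⟩ := intermediate_value_Ioo' hpq.le hg.continuousOn (show (0 : ℝ) ∈ _ from
    ⟨hq, hp⟩)
  refine ⟨z, hz, hgz, fun x hx => ?_, fun x hx => ?_⟩
  · by_contra! hcon
    have hpx : p < x := lt_of_le_of_ne hx.1 (by rintro rfl; linarith)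
    obtain ⟨y, hy, hgy⟩ := intermediate_value_Ioc' hx.1 hg.continuousOn
      (show (0 : ℝ) ∈ _ from ⟨hcon, hp⟩)
    have := huniq y ⟨hy.1, hy.2.trans_lt (hx.2.trans hz.2)⟩ z hz hgy hgz
    linarith [hy.2, hx.2]
  · by_contra! hcon
    have hpx : x < q := lt_of_le_of_ne hx.2 (by rintro rfl; linarith)
    obtain ⟨y, hy, hgy⟩ := intermediate_value_Ico' hx.2 hg.continuousOn
      (show (0 : ℝ) ∈ _ from ⟨hq, hcon⟩)
    have := huniq y ⟨(hz.1.trans hx.1).trans_le hy.1, hy.2⟩ z hz hgy hgz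
    linarith [hy.1, hx.1]

theorem continuousOn_of_sign_change {g : ℝ → ℝ → ℝ} (hg : ∀ φ, Continuous fun E => g E φ)
    {s : Set ℝ} {p q : ℝ} {z : ℝ → ℝ} (hz : ∀ E ∈ s, z E ∈ Icc p q) (h0 : ∀ E ∈ s, g E (z E) = 0)
    (hpos : ∀ E ∈ s, ∀ x ∈ Ico p (z E), 0 < g E x)
    (hneg : ∀ E ∈ s, ∀ x ∈ Ioc (z E) q, g E x < 0) : ContinuousOn z s := by
  intro E hE
  refine tendsto_order.2 ⟨fun c hc => ?_, fun c hc => ?_⟩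
  · rcases lt_or_ge c p with hcp | hcp
    · filter_upwards [self_mem_nhdsWithin] with E' hE' using hcp.trans_le (hz E' hE').1
    · filter_upwards [self_mem_nhdsWithin, nhdsWithin_le_nhds <|
        continuousAt_const.eventually_lt (hg c).continuousAt (hpos E hE c ⟨hcp, hc⟩)] with
        E' hE' hlt
      by_contra! hcon
      rcases hcon.eq_or_lt with heq | hlt'
      · rw [← heq, h0 E' hE'] at hlt
        exact hlt.false
      · linarith [hneg E' hE' c ⟨hlt', hc.le.trans (hz E hE).2⟩]
  · rcases lt_or_ge q c with hcp | hcp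
    · filter_upwards [self_mem_nhdsWithin] with E' hE' using (hz E' hE').2.trans_lt hcp
    · filter_upwards [self_mem_nhdsWithin, nhdsWithin_le_nhds <| (hg c).continuousAt.eventually_lt
        continuousAt_const (hneg E hE c ⟨hc, hcp⟩)] with
        E' hE' hlt
      by_contra! hcon
      rcases hcon.eq_or_lt with heq | hlt'
      · rw [heq, h0 E' hE'] at hlt
        exact hlt.false
      · linarith [hpos E' hE' c ⟨(hz E hE).1.trans hc.le, hlt'⟩]

theorem sin_ne_zero_of_mem_Ioo {w z : ℝ} (h : z ∈ Ioo w (w + π)) : sin (z - w) ≠ 0 :=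
  (sin_pos_of_pos_of_lt_pi (by linarith [h.1]) (by linarith [h.2])).ne'

namespace AngleLift

variable {A : ℝ → Matrix (Fin 2) (Fin 2) ℝ} {θ : ℝ → ℝ → ℝ} (h : AngleLift A θ)
include h

theorem trace_sq_eq_four_of_three {E w z y : ℝ} (hw : θ E w = w) (hz : θ E z = z) (hy : θ E y = y)
    (hwz : w < z) (hzy : z < y) (hyw : y < w + π) : (A E).trace ^ 2 = 4 := by
  obtain ⟨a, ha⟩ := h.isEigenAngle (E := E) (φ := w) (by simp [hw])
  obtain ⟨b, hb⟩ := h.isEigenAngle (E := E) (φ := z) (by simp [hz])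
  obtain ⟨c, hc⟩ := h.isEigenAngle (E := E) (φ := y) (by simp [hy])
  have s1 := sin_ne_zero_of_mem_Ioo (w := w) (z := z) ⟨hwz, by linarith⟩
  have s2 := sin_ne_zero_of_mem_Ioo (w := z) (z := y) ⟨hzy, by linarith⟩
  have s3 := sin_ne_zero_of_mem_Ioo (w := w) (z := y) ⟨by linarith, by linarith⟩
  have e1 := ha.mul_eq_one hb (h.det_eq_one E) s1
  have e2 := hb.mul_eq_one hc (h.det_eq_one E) s2
  have e3 := ha.mul_eq_one hc (h.det_eq_one E) s3
  rw [ha.trace_eq hb s1]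
  have hbc : b = a := by linear_combination (-b) * e3 + a * e2
  rw [hbc] at e1 ⊢
  linear_combination 4 * e1

theorem eq_self_of_two {E w z : ℝ} (ht : (A E).trace ^ 2 = 4) (hw : θ E w = w) (hz : θ E z = z)
    (hwz : z ∈ Ioo w (w + π)) (ψ : ℝ) : θ E ψ = ψ := by
  obtain ⟨a, ha⟩ := h.isEigenAngle (E := E) (φ := w) (by simp [hw])
  obtain ⟨b, hb⟩ := h.isEigenAngle (E := E) (φ := z) (by simp [hz])
  have s1 := sin_ne_zero_of_mem_Ioo hwz
  have e1 := ha.mul_eq_one hb (h.det_eq_one E) s1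
  rw [ha.trace_eq hb s1] at ht
  have hab : b = a := by
    have : (a - b) ^ 2 = 0 := by linear_combination ht - 4 * e1
    linarith [pow_eq_zero_iff (two_ne_zero) |>.1 this]
  rw [hab] at hb
  obtain ⟨r, hr, h1, h2⟩ := h.spec E ψ
  obtain ⟨a1, a2⟩ := ha
  obtain ⟨b1, b2⟩ := hb
  have key : r * sin (θ E ψ - ψ) * sin (z - w) = 0 := by
    rw [sin_sub (θ E ψ), sin_sub z]
    linear_combination (-h1 * cos ψ + h2 * sin ψ) * (sin z * cos w - cos z * sin w) +
      cos ψ * ((sin z * cos ψ - cos z * sin ψ) * a1 + (sin ψ * cos w - cos ψ * sin w) * b1) -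
      sin ψ * ((sin z * cos ψ - cos z * sin ψ) * a2 + (sin ψ * cos w - cos ψ * sin w) * b2)
  have h0 : sin (θ E ψ - ψ) = 0 :=
    (mul_eq_zero.1 ((mul_eq_zero.1 key).resolve_right s1)).resolve_left hr
  obtain ⟨n, hn⟩ := sin_eq_zero_iff.1 h0
  have : n = 0 := h.int_unique (E := E) (φ := ψ) (ψ := w) (by linarith) (by simp [hw])
  rw [this] at hn
  push_cast at hn
  linarith

theorem neg_of_left_edge {E w : ℝ} (ht : (A E).trace ^ 2 = 4)
    (hgap : ∀ᶠ E' in 𝓝[>] E, 4 ≤ (A E').trace ^ 2) (hw : θ E w = w) {φ : ℝ}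
    (hφ : φ ∈ Ioo w (w + π)) : θ E φ < φ := by
  have hnot : ¬ ∀ ψ, 0 ≤ θ E ψ - ψ := by
    intro hcon
    have := h.eventually_trace_sq_lt (E := E) (φ := w) (j := 0) (by simp [hw]) (by simpa using hcon)
    obtain ⟨x, hx⟩ := (this.and hgap).exists
    linarith
  have hne : ∀ z ∈ Ioo w (w + π), θ E z - z ≠ 0 := by
    intro z hz hcon
    refine hnot fun ψ => ?_
    rw [h.eq_self_of_two ht hw (by linarith) hz ψ, sub_self]
  by_contra! hcon
  refine hnot fun ψ => ?_
  by_contra! hψ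
  obtain ⟨χ, hχ, hd⟩ := h.exists_mem_Ico E ψ w
  rcases hχ.1.eq_or_lt with heq | hlt
  · rw [← heq, hw] at hd
    linarith
  · obtain ⟨z, hz, hz0⟩ := isPreconnected_Ioo.intermediate_value ⟨hlt, hχ.2⟩ hφ
      ((h.cont_angle E).sub continuous_id).continuousOn
      (show (0 : ℝ) ∈ Icc _ _ from
        ⟨sub_nonpos.2 (by change θ E χ ≤ χ; linarith), sub_nonneg.2 hcon⟩)
    exact hne z hz (by simpa using hz0)

theorem pos_of_right_edge {E w : ℝ} (ht : (A E).trace ^ 2 = 4)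
    (hgap : ∀ᶠ E' in 𝓝[<] E, 4 ≤ (A E').trace ^ 2) (hw : θ E w = w) {φ : ℝ}
    (hφ : φ ∈ Ioo (w - π) w) : φ < θ E φ := by
  have := h.reflect.neg_of_left_edge (E := -E) (w := -w) (φ := -φ) ?_ ?_ (by simpa using hw)
    ⟨by linarith [hφ.2], by linarith [hφ.1]⟩
  · simpa using this
  · rw [← ht]; simp [Matrix.trace_fin_two]
  · have ht : Tendsto (fun x : ℝ => -x) (𝓝[>] (-E)) (𝓝[<] E) := by
      simpa using tendsto_neg_nhdsGT (a := -E)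
    filter_upwards [ht.eventually hgap] with x hx
    simpa [Matrix.trace_fin_two] using hx

/-- If directions between the eigendirections `y < x` are rotated towards `x`, then `x` is the
expanding eigendirection and `y` the contracting one. -/
theorem exists_hyperbolic {E x w y : ℝ} (hx : θ E x = x) (hy : θ E y = y) (hw : w < θ E w)
    (hyw : y < w) (hwx : w < x) (hxy : x < y + π) :
    ∃ c, 1 < c ^ 2 ∧ IsEigenAngle (A E) c x ∧ IsEigenAngle (A E) c⁻¹ y := by
  obtain ⟨a, ha⟩ := h.isEigenAngle (E := E) (φ := x) (by simp [hx])
  obtain ⟨b, hb⟩ := h.isEigenAngle (E := E) (φ := y) (by simp [hy])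
  have s1 := sin_ne_zero_of_mem_Ioo (w := y) (z := x) ⟨by linarith, by linarith⟩
  have e1 := hb.mul_eq_one ha (h.det_eq_one E) s1
  have hba : b = a⁻¹ := eq_inv_of_mul_eq_one_left e1
  refine ⟨a, ?_, ha, hba ▸ hb⟩
  obtain ⟨r, hr, h1, h2⟩ := h.spec E w
  have hθx : θ E w < x := by rw [← hx]; exact h.mono_angle E hwx
  set t := θ E w with htdef
  have p1 : 0 < sin (t - y) := sin_pos_of_pos_of_lt_pi (by linarith) (by linarith)
  have p2 : 0 < sin (x - t) := sin_pos_of_pos_of_lt_pi (by linarith) (by linarith)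
  have p3 : 0 < sin (w - y) := sin_pos_of_pos_of_lt_pi (by linarith) (by linarith)
  have p4 : 0 < sin (x - w) := sin_pos_of_pos_of_lt_pi (by linarith) (by linarith)
  have p5 : 0 < sin (x - y) := sin_pos_of_pos_of_lt_pi (by linarith) (by linarith)
  have p6 : 0 < sin (t - w) := sin_pos_of_pos_of_lt_pi (by linarith) (by linarith)
  have ptol : sin (t - y) * sin (x - w) - sin (w - y) * sin (x - t) =
      sin (x - y) * sin (t - w) := by
    simp only [sin_sub]
    ring
  obtain ⟨a1, a2⟩ := ha
  obtain ⟨b1, b2⟩ := hb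
  have k1 : a * sin (w - y) = r * sin (t - y) := by
    have : a * sin (w - y) * sin (x - y) = r * sin (t - y) * sin (x - y) := by
      simp only [sin_sub]
      linear_combination (sin x * cos y - cos x * sin y) * (cos y * h1 - sin y * h2) -
        (sin w * cos y - cos w * sin y) * (cos y * a1 - sin y * a2) -
        (sin x * cos w - cos x * sin w) * (cos y * b1 - sin y * b2)
    exact mul_right_cancel₀ p5.ne' this
  have k2 : b * sin (x - w) = r * sin (x - t) := by
    have : b * sin (x - w) * sin (x - y) = r * sin (x - t) * sin (x - y) := by
      simp only [sin_sub]
      linear_combination (sin x * cos y - cos x * sin y) * (sin x * h2 - cos x * h1) -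
        (sin w * cos y - cos w * sin y) * (sin x * a2 - cos x * a1) -
        (sin x * cos w - cos x * sin w) * (sin x * b2 - cos x * b1)
    exact mul_right_cancel₀ p5.ne' this
  have ha0 : a ≠ 0 := by rintro rfl; simp at e1
  have k3 : a ^ 2 * (sin (w - y) * sin (x - t)) = sin (t - y) * sin (x - w) := by
    have : r * (a ^ 2 * (sin (w - y) * sin (x - t))) = r * (sin (t - y) * sin (x - w)) := by
      linear_combination (-a ^ 2 * sin (w - y)) * k2 + a * sin (w - y) * sin (x - w) * e1 +
        sin (x - w) * k1
    exact mul_left_cancel₀ hr this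
  have p7 : 0 < sin (w - y) * sin (x - t) := mul_pos p3 p2
  have p8 : 0 < sin (x - y) * sin (t - w) := mul_pos p5 p6
  by_contra! hcon
  nlinarith

theorem exists_gap_directions {E₀ E₁ : ℝ} (hlt : E₀ < E₁)
    (hG : ∀ E ∈ Ioo E₀ E₁, 4 < (A E).trace ^ 2) (h0 : (A E₀).trace ^ 2 = 4)
    (h1 : (A E₁).trace ^ 2 = 4) :
    ∃ α β : ℝ → ℝ, ContinuousOn α (Icc E₀ E₁) ∧ ContinuousOn β (Icc E₀ E₁) ∧
      StrictMonoOn α (Icc E₀ E₁) ∧ StrictAntiOn β (Icc E₀ E₁) ∧ α E₀ = β E₀ ∧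
      α E₁ = β E₁ + π ∧ ∀ E ∈ Ioo E₀ E₁, ∃ c, 1 < c ^ 2 ∧ IsEigenAngle (A E) c (α E) ∧
        IsEigenAngle (A E) c⁻¹ (β E) := by
  wlog hw : ∃ w, θ E₀ w = w generalizing θ with H
  · obtain ⟨w, m, hwm⟩ := (h.four_le_trace_sq_iff E₀).1 h0.ge
    exact H (h.sub_int_mul_pi m) ⟨w, by simp [hwm]⟩
  obtain ⟨w₀, hw₀⟩ := hw
  have hR : ∀ E ∈ Icc E₀ E₁, 4 ≤ (A E).trace ^ 2 := by
    intro E hE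
    rcases hE.1.eq_or_lt with rfl | hl
    · exact h0.ge
    rcases hE.2.eq_or_lt with rfl | hr
    · exact h1.ge
    exact (hG E ⟨hl, hr⟩).le
  obtain ⟨w₁, hw₁m, hw₁⟩ : ∃ w₁ ∈ Ico w₀ (w₀ + π), θ E₁ w₁ = w₁ := by
    obtain ⟨v, m, hv⟩ := (h.four_le_trace_sq_iff E₁).1 h1.ge
    have hm : m = 0 := h.int_eq_of_isPreconnected isPreconnected_Icc hR (right_mem_Icc.2 hlt.le)
      (left_mem_Icc.2 hlt.le) hv (show θ E₀ w₀ = w₀ + (0 : ℤ) * π by simp [hw₀])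
    obtain ⟨ψ, hψ, hd⟩ := h.exists_mem_Ico E₁ v w₀
    refine ⟨ψ, hψ, ?_⟩
    rw [hv, hm] at hd
    simp only [Int.cast_zero, zero_mul] at hd
    linarith
  have hw₀lt : ∀ E, E₀ < E → w₀ < θ E w₀ := fun E hE => by
    simpa [hw₀] using h.mono_energy w₀ hE
  have hw₁lt : ∀ E, E < E₁ → θ E w₁ < w₁ := fun E hE => by
    simpa [hw₁] using h.mono_energy w₁ hE
  have hww : w₀ < w₁ := lt_of_le_of_ne hw₁m.1 (by
    rintro heq
    have := hw₀lt E₁ hlt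
    rw [heq, hw₁] at this
    exact this.false)
  have hA : ∀ φ ∈ Ioo w₀ (w₀ + π), θ E₀ φ < φ := fun φ hφ => by
    refine h.neg_of_left_edge h0 ?_ hw₀ hφ
    filter_upwards [Ioo_mem_nhdsGT hlt] with E hE using (hG E hE).le
  have hB : ∀ φ ∈ Ioo (w₁ - π) w₁, φ < θ E₁ φ := fun φ hφ => by
    refine h.pos_of_right_edge h1 ?_ hw₁ hφ
    filter_upwards [Ioo_mem_nhdsLT hlt] with E hE using (hG E hE).le
  have hsub : ∀ E φ, θ E (φ - π) = θ E φ - π := fun E φ => by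
    have := h.add_pi E (φ - π)
    rw [sub_add_cancel] at this
    linarith
  have hd : ∀ E, Continuous fun φ => θ E φ - φ := fun E => (h.cont_angle E).sub continuous_id
  have hα : ∀ E ∈ Icc E₀ E₁, ∃ z ∈ Icc w₀ w₁, θ E z - z = 0 ∧
      (∀ x ∈ Ico w₀ z, 0 < θ E x - x) ∧ ∀ x ∈ Ioc z w₁, θ E x - x < 0 := by
    intro E hE
    rcases hE.1.eq_or_lt with rfl | hl
    · exact ⟨w₀, ⟨le_rfl, hww.le⟩, by simp [hw₀], by simp, fun x hx =>
        sub_neg.2 (hA x ⟨hx.1, hx.2.trans_lt hw₁m.2⟩)⟩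
    rcases hE.2.eq_or_lt with rfl | hr
    · exact ⟨w₁, ⟨hww.le, le_rfl⟩, by simp [hw₁], fun x hx =>
        sub_pos.2 (hB x ⟨by linarith [hx.1, hw₁m.2], hx.2⟩), by simp⟩
    obtain ⟨b, hb, hb0⟩ := intermediate_value_Ioo (show w₁ - π ≤ w₀ by linarith [hw₁m.2])
      (hd E).continuousOn (show (0 : ℝ) ∈ _ from
        ⟨by rw [hsub]; linarith [hw₁lt E hr], sub_pos.2 (hw₀lt E hl)⟩)
    have huniq : ∀ x ∈ Ioo w₀ w₁, ∀ y ∈ Ioo w₀ w₁, θ E x - x = 0 → θ E y - y = 0 → ¬ x < y := by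
      intro x hx y hy hx0 hy0 hxy
      have := h.trace_sq_eq_four_of_three (E := E) (w := b) (z := x) (y := y)
        (sub_eq_zero.1 hb0) (sub_eq_zero.1 hx0) (sub_eq_zero.1 hy0) (hb.2.trans hx.1) hxy
        (by linarith [hy.2, hb.1])
      linarith [hG E ⟨hl, hr⟩]
    obtain ⟨z, hz, hz'⟩ := exists_zero_sign_change (hd E) hww (sub_pos.2 (hw₀lt E hl))
      (sub_neg.2 (hw₁lt E hr)) fun x hx y hy hx0 hy0 =>
        le_antisymm (not_lt.1 (huniq y hy x hx hy0 hx0)) (not_lt.1 (huniq x hx y hy hx0 hy0))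
    exact ⟨z, Ioo_subset_Icc_self hz, hz'⟩
  have hβ : ∀ E ∈ Icc E₀ E₁, ∃ z ∈ Icc (w₁ - π) w₀, -(θ E z - z) = 0 ∧
      (∀ x ∈ Ico (w₁ - π) z, 0 < -(θ E x - x)) ∧ ∀ x ∈ Ioc z w₀, -(θ E x - x) < 0 := by
    intro E hE
    rcases hE.1.eq_or_lt with rfl | hl
    · refine ⟨w₀, ⟨by linarith [hw₁m.2], le_rfl⟩, by simp [hw₀], fun x hx => ?_, by simp⟩
      have := hA (x + π) ⟨by linarith [hx.1], by linarith [hx.2]⟩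
      rw [h.add_pi] at this
      linarith
    rcases hE.2.eq_or_lt with rfl | hr
    · refine ⟨w₁ - π, ⟨le_rfl, by linarith [hw₁m.2]⟩, by simp [hsub, hw₁], by simp, fun x hx => ?_⟩
      have := hB x ⟨hx.1, hx.2.trans_lt hww⟩
      linarith
    obtain ⟨a, ha, ha0⟩ := intermediate_value_Ioo' hww.le (hd E).continuousOn
      (show (0 : ℝ) ∈ _ from ⟨sub_neg.2 (hw₁lt E hr), sub_pos.2 (hw₀lt E hl)⟩)
    have huniq : ∀ x ∈ Ioo (w₁ - π) w₀, ∀ y ∈ Ioo (w₁ - π) w₀, -(θ E x - x) = 0 →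
        -(θ E y - y) = 0 → ¬ x < y := by
      intro x hx y hy hx0 hy0 hxy
      have := h.trace_sq_eq_four_of_three (E := E) (w := x) (z := y) (y := a)
        (by linarith) (by linarith) (sub_eq_zero.1 ha0) hxy (hy.2.trans ha.1)
        (by linarith [ha.2, hx.1])
      linarith [hG E ⟨hl, hr⟩]
    obtain ⟨z, hz, hz'⟩ := exists_zero_sign_change (hd E).neg
      (show w₁ - π < w₀ by linarith [hw₁m.2])
      (by change 0 < -(θ E (w₁ - π) - (w₁ - π)); rw [hsub]; linarith [hw₁lt E hr])
      (by change -(θ E w₀ - w₀) < 0; linarith [hw₀lt E hl]) fun x hx y hy hx0 hy0 =>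
        le_antisymm (not_lt.1 (huniq y hy x hx hy0 hx0)) (not_lt.1 (huniq x hx y hy hx0 hy0))
    exact ⟨z, Ioo_subset_Icc_self hz, hz'⟩
  choose! α hα using hα
  choose! β hβ using hβ
  have e₀ : E₀ ∈ Icc E₀ E₁ := left_mem_Icc.2 hlt.le
  have e₁ : E₁ ∈ Icc E₀ E₁ := right_mem_Icc.2 hlt.le
  have hα₀ : α E₀ = w₀ := by
    obtain ⟨hm, hz, -⟩ := hα E₀ e₀
    by_contra hne
    linarith [hA (α E₀) ⟨lt_of_le_of_ne hm.1 (Ne.symm hne), hm.2.trans_lt hw₁m.2⟩]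
  have hα₁ : α E₁ = w₁ := by
    obtain ⟨hm, hz, -⟩ := hα E₁ e₁
    by_contra hne
    linarith [hB (α E₁) ⟨by linarith [hm.1, hw₁m.2], lt_of_le_of_ne hm.2 hne⟩]
  have hβ₀ : β E₀ = w₀ := by
    obtain ⟨hm, hz, -⟩ := hβ E₀ e₀
    by_contra hne
    have := hA (β E₀ + π) ⟨by linarith [hm.1], by linarith [lt_of_le_of_ne hm.2 hne]⟩
    rw [h.add_pi] at this
    linarith
  have hβ₁ : β E₁ = w₁ - π := by
    obtain ⟨hm, hz, -⟩ := hβ E₁ e₁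
    by_contra hne
    linarith [hB (β E₁) ⟨lt_of_le_of_ne hm.1 (Ne.symm hne), hm.2.trans_lt hww⟩]
  refine ⟨α, β, ?_, ?_, ?_, ?_, by rw [hα₀, hβ₀], by rw [hα₁, hβ₁]; ring, ?_⟩
  · exact continuousOn_of_sign_change (g := fun E φ => θ E φ - φ)
      (fun φ => (h.cont_energy φ).sub continuous_const) (fun E hE => (hα E hE).1)
      (fun E hE => (hα E hE).2.1) (fun E hE => (hα E hE).2.2.1) (fun E hE => (hα E hE).2.2.2)
  · exact continuousOn_of_sign_change (g := fun E φ => -(θ E φ - φ))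
      (fun φ => ((h.cont_energy φ).sub continuous_const).neg) (fun E hE => (hβ E hE).1)
      (fun E hE => (hβ E hE).2.1) (fun E hE => (hβ E hE).2.2.1) (fun E hE => (hβ E hE).2.2.2)
  · intro E hE E' hE' hEE'
    by_contra! hcon
    have hm := h.mono_energy (α E) hEE'
    have hz := (hα E hE).2.1
    simp only at hm
    rcases hcon.eq_or_lt with heq | hl
    · have hz' := (hα E' hE').2.1
      rw [heq] at hz'
      linarith
    · linarith [(hα E' hE').2.2.2 (α E) ⟨hl, (hα E hE).1.2⟩]
  · intro E hE E' hE' hEE'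
    by_contra! hcon
    have hm := h.mono_energy (β E) hEE'
    have hz := (hβ E hE).2.1
    simp only at hm
    rcases hcon.eq_or_lt with heq | hl
    · have hz' := (hβ E' hE').2.1
      rw [← heq] at hz'
      linarith
    · linarith [(hβ E' hE').2.2.1 (β E) ⟨(hβ E hE).1.1, hl⟩]
  · intro E hE
    obtain ⟨ha, haz, -⟩ := hα E (Ioo_subset_Icc_self hE)
    obtain ⟨hb, hbz, -⟩ := hβ E (Ioo_subset_Icc_self hE)
    have l0 := hw₀lt E hE.1
    have l1 := hw₁lt E hE.2
    have n1 : w₀ ≠ α E := fun heq => by rw [← heq] at haz; linarith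
    have n2 : β E ≠ w₀ := fun heq => by rw [heq] at hbz; linarith
    have n3 : α E ≠ w₁ := fun heq => by rw [heq] at haz; linarith
    have l2 := lt_of_le_of_ne ha.2 n3
    exact h.exists_hyperbolic (by linarith) (by linarith) l0 (lt_of_le_of_ne hb.2 n2)
      (lt_of_le_of_ne ha.1 n1) (by linarith [hb.1])

theorem osc_lt_pi (E φ ψ : ℝ) : θ E ψ - ψ < θ E φ - φ + π := by
  obtain ⟨χ, hχ, hd⟩ := h.exists_mem_Ico E ψ (φ - π)
  rw [← hd]
  rw [sub_add_cancel] at hχ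
  linarith [h.mono_angle E hχ.2, hχ.1]

theorem exists_eq_iff {E₀ E₁ : ℝ} (hlt : E₀ < E₁) (j : ℤ) :
    (∃ E ∈ Ioo E₀ E₁, ∃ φ, θ E φ = φ + j * π) ↔
      (∃ φ, θ E₀ φ - φ < j * π) ∧ ∃ φ, j * π < θ E₁ φ - φ := by
  have hc : ∀ φ, Continuous fun E => θ E φ - φ := fun φ => (h.cont_energy φ).sub continuous_const
  constructor
  · rintro ⟨E, hE, φ, hφ⟩
    have h1 := h.mono_energy φ hE.1
    have h2 := h.mono_energy φ hE.2
    exact ⟨⟨φ, by linarith⟩, ⟨φ, by linarith⟩⟩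
  · rintro ⟨⟨φ, hφ⟩, ⟨ψ, hψ⟩⟩
    have hx : ∀ᶠ x in 𝓝[>] E₀, θ x φ - φ < j * π :=
      nhdsWithin_le_nhds ((hc φ).continuousAt.eventually_lt continuousAt_const hφ)
    have hy : ∀ᶠ x in 𝓝[<] E₁, j * π < θ x ψ - ψ :=
      nhdsWithin_le_nhds (continuousAt_const.eventually_lt (hc ψ).continuousAt hψ)
    obtain ⟨x, hx, hxm⟩ := (hx.and (Ioo_mem_nhdsGT hlt)).exists
    obtain ⟨y, hy, hym⟩ := (hy.and (Ioo_mem_nhdsLT hlt)).exists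
    obtain ⟨⟨E, χ⟩, hm, he⟩ := (isPreconnected_Ioo.prod isPreconnected_univ).intermediate_value
      (show (x, φ) ∈ Ioo E₀ E₁ ×ˢ univ from ⟨hxm, mem_univ _⟩)
      (show (y, ψ) ∈ Ioo E₀ E₁ ×ˢ univ from ⟨hym, mem_univ _⟩)
      (h.cont.sub continuous_snd).continuousOn (show (j : ℝ) * π ∈ Icc _ _ from ⟨hx.le, hy.le⟩)
    refine ⟨E, hm.1, χ, ?_⟩
    change θ E χ - χ = j * π at he
    linarith

theorem encard_bounds {E₀ E₁ : ℝ} (hlt : E₀ < E₁) {α β : ℝ → ℝ} (hα : ContinuousOn α (Icc E₀ E₁))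
    (hβ : ContinuousOn β (Icc E₀ E₁)) (hαm : StrictMonoOn α (Icc E₀ E₁))
    (hβm : StrictAntiOn β (Icc E₀ E₁)) (h0 : α E₀ = β E₀) (h1 : α E₁ = β E₁ + π) :
    {j : ℤ | ∃ E ∈ Ioo E₀ E₁, ∃ φ, θ E φ = φ + j * π}.encard + 1 ≤
        {E ∈ Ioo E₀ E₁ | sin (θ E (α E) - β E) = 0}.encard +
          ({E₀, E₁} ∩ {E | 4 ≤ (A E).trace ^ 2}).encard ∧
      {E ∈ Ioo E₀ E₁ | sin (θ E (α E) - β E) = 0}.encard ≤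
        {j : ℤ | ∃ E ∈ Ioo E₀ E₁, ∃ φ, θ E φ = φ + j * π}.encard + 1 := by
  have e₀ : E₀ ∈ Icc E₀ E₁ := left_mem_Icc.2 hlt.le
  have e₁ : E₁ ∈ Icc E₀ E₁ := right_mem_Icc.2 hlt.le
  set f : ℝ → ℝ := fun E => θ E (α E) - β E with hf
  have hfc : ContinuousOn f (Icc E₀ E₁) :=
    (h.cont.comp_continuousOn (continuousOn_id.prodMk hα)).sub hβ
  have hfm : StrictMonoOn f (Icc E₀ E₁) := by
    intro x hx y hy hxy
    have i1 := h.mono_energy (α x) hxy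
    have i2 := h.mono_angle y (hαm hx hy hxy)
    have i3 := hβm hx hy hxy
    simp only [hf] at i1 ⊢
    linarith
  have hf0 : f E₀ = θ E₀ (α E₀) - α E₀ := by simp only [hf, h0]
  have hf1 : f E₁ = θ E₁ (α E₁) - α E₁ + π := by simp only [hf]; rw [h1]; ring
  set J : Set ℤ := {j | ∃ E ∈ Ioo E₀ E₁, ∃ φ, θ E φ = φ + j * π} with hJ
  set D : Set ℝ := {E ∈ Ioo E₀ E₁ | sin (f E) = 0} with hD
  set K : Set ℤ := {j | f E₀ < j * π ∧ j * π < f E₁} with hK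
  have hDK : D.encard = K.encard := by
    have hex : ∀ j ∈ K, ∃ E ∈ Ioo E₀ E₁, f E = j * π := fun j hj =>
      intermediate_value_Ioo hlt.le hfc ⟨hj.1, hj.2⟩
    choose! e he using hex
    have hinj : InjOn e K := by
      intro i hi j hj hij
      have : (i : ℝ) * π = j * π := by rw [← (he i hi).2, ← (he j hj).2, hij]
      exact_mod_cast mul_right_cancel₀ pi_ne_zero this
    rw [← hinj.encard_image]
    congr 1
    ext E
    constructor
    · rintro ⟨hE, hs⟩
      obtain ⟨n, hn⟩ := sin_eq_zero_iff.1 hs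
      have hE' := Ioo_subset_Icc_self hE
      have hnK : n ∈ K := ⟨by rw [hn]; exact hfm e₀ hE' hE.1, by rw [hn]; exact hfm hE' e₁ hE.2⟩
      exact ⟨n, hnK, hfm.injOn (Ioo_subset_Icc_self (he n hnK).1) hE' (by rw [(he n hnK).2, hn])⟩
    · rintro ⟨j, hj, rfl⟩
      exact ⟨(he j hj).1, by rw [(he j hj).2]; exact sin_int_mul_pi j⟩
  rw [hDK]
  set P : ℤ → Prop := fun j => ∃ φ, θ E₀ φ - φ < j * π with hP
  set Q : ℤ → Prop := fun j => ∃ φ, j * π < θ E₁ φ - φ with hQ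
  have hJiff : ∀ j, j ∈ J ↔ P j ∧ Q j := h.exists_eq_iff hlt
  have cast_lt : ∀ {i j : ℤ}, (i : ℝ) * π < j * π → i < j := fun hij => by
    exact_mod_cast lt_of_mul_lt_mul_right hij pi_pos.le
  have lt_cast : ∀ {i j : ℤ}, i ≤ j → (i : ℝ) * π ≤ j * π := fun hij => by
    exact mul_le_mul_of_nonneg_right (by exact_mod_cast hij) pi_pos.le
  have hQdown : ∀ {i j}, i ≤ j → Q j → Q i := by
    rintro i j hij ⟨φ, hφ⟩
    exact ⟨φ, (lt_cast hij).trans_lt hφ⟩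
  obtain ⟨m, hmQ, hm⟩ : ∃ m, Q (m - 1) ∧ ¬ Q m := by
    obtain ⟨u, hu, hmax⟩ := Int.exists_greatest_of_bdd (P := Q)
      ⟨⌈(θ E₁ 0 - 0 + π) / π⌉, fun z ⟨φ, hz⟩ => by
        have i1 := h.osc_lt_pi E₁ 0 φ
        have i2 := Int.le_ceil ((θ E₁ 0 - 0 + π) / π)
        rw [div_le_iff₀ pi_pos] at i2
        exact (cast_lt (by linarith)).le⟩
      ⟨⌊(θ E₁ 0 - 0) / π⌋ - 1, 0, by
        have i2 := Int.floor_le ((θ E₁ 0 - 0) / π)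
        rw [le_div_iff₀ pi_pos] at i2
        push_cast
        linarith [pi_pos]⟩
    refine ⟨u + 1, by simpa using hu, fun hcon => ?_⟩
    have := hmax _ hcon
    omega
  have hmJ : m ∉ J := fun hcon => hm ((hJiff m).1 hcon).2
  have hupper : K ⊆ insert m J := by
    rintro j ⟨j1, j2⟩
    rw [hf0] at j1
    rw [hf1] at j2
    by_cases hj : Q j
    · exact mem_insert_of_mem _ ((hJiff j).2 ⟨⟨α E₀, j1⟩, hj⟩)
    · have hj1 : Q (j - 1) := ⟨α E₁, by push_cast; linarith⟩
      refine mem_insert_iff.2 (Or.inl (le_antisymm ?_ ?_))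
      · by_contra! hcon
        exact hm (hQdown (by omega) hj1)
      · by_contra! hcon
        exact hj (hQdown (by omega) hmQ)
  refine ⟨?_, (encard_le_encard hupper).trans (encard_insert_of_notMem hmJ).le⟩
  set S₀ : Set ℤ := {j | P j ∧ j * π ≤ f E₀} with hS₀
  set S₁ : Set ℤ := {j | Q (j - 1) ∧ f E₁ ≤ j * π} with hS₁
  have hcover : insert m J ⊆ K ∪ (S₀ ∪ S₁) := by
    intro j hj
    have hPQ : P j ∧ Q (j - 1) := by
      rcases mem_insert_iff.1 hj with rfl | hj
      · refine ⟨⟨0, ?_⟩, hmQ⟩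
        have : θ E₁ 0 - 0 ≤ j * π := by
          by_contra! hcon
          exact hm ⟨0, hcon⟩
        linarith [h.mono_energy 0 hlt]
      · exact ⟨((hJiff j).1 hj).1, hQdown (by omega) ((hJiff j).1 hj).2⟩
    by_cases k0 : f E₀ < j * π
    · by_cases k1 : j * π < f E₁
      · exact Or.inl ⟨k0, k1⟩
      · exact Or.inr (Or.inr ⟨hPQ.2, not_lt.1 k1⟩)
    · exact Or.inr (Or.inl ⟨hPQ.1, not_lt.1 k0⟩)
  have hS₀le : S₀.encard ≤ ({E₀} ∩ {E | 4 ≤ (A E).trace ^ 2}).encard := by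
    rcases S₀.eq_empty_or_nonempty with hem | ⟨j, ⟨φ, hφ⟩, hj⟩
    · simp [hem]
    · have hmem : {E₀} ∩ {E | 4 ≤ (A E).trace ^ 2} = {E₀} := by
        refine inter_eq_left.2 (singleton_subset_iff.2 ?_)
        obtain ⟨χ, hχ⟩ := h.exists_eq_of_le_of_le hφ.le (hj.trans hf0.le)
        exact (h.four_le_trace_sq_iff E₀).2 ⟨χ, j, hχ⟩
      rw [hmem, encard_singleton, encard_le_one_iff]
      have key : ∀ i j, i ∈ S₀ → j ∈ S₀ → j ≤ i := by
        rintro i j ⟨⟨φ, hφ⟩, -⟩ ⟨-, hj⟩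
        have i1 := h.osc_lt_pi E₀ φ (α E₀)
        have : (j : ℝ) * π < ((i + 1 : ℤ) : ℝ) * π := by push_cast; linarith
        have := cast_lt this
        omega
      exact fun i j hi hj => le_antisymm (key j i hj hi) (key i j hi hj)
  have hS₁le : S₁.encard ≤ ({E₁} ∩ {E | 4 ≤ (A E).trace ^ 2}).encard := by
    rcases S₁.eq_empty_or_nonempty with hem | ⟨j, ⟨φ, hφ⟩, hj⟩
    · simp [hem]
    · have hmem : {E₁} ∩ {E | 4 ≤ (A E).trace ^ 2} = {E₁} := by
        refine inter_eq_left.2 (singleton_subset_iff.2 ?_)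
        obtain ⟨χ, hχ⟩ := h.exists_eq_of_le_of_le (φ := α E₁) (c := ((j - 1 : ℤ) : ℝ) * π)
          (by push_cast; linarith) hφ.le
        exact (h.four_le_trace_sq_iff E₁).2 ⟨χ, j - 1, hχ⟩
      rw [hmem, encard_singleton, encard_le_one_iff]
      have key : ∀ i j, i ∈ S₁ → j ∈ S₁ → j ≤ i := by
        rintro i j ⟨-, hi⟩ ⟨⟨φ, hφ⟩, -⟩
        have i1 := h.osc_lt_pi E₁ (α E₁) φ
        have : ((j - 1 : ℤ) : ℝ) * π < (i : ℝ) * π := by linarith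
        have := cast_lt this
        omega
      exact fun i j hi hj => le_antisymm (key j i hj hi) (key i j hi hj)
  have hdisj : Disjoint ({E₀} ∩ {E | 4 ≤ (A E).trace ^ 2}) ({E₁} ∩ {E | 4 ≤ (A E).trace ^ 2}) :=
    (disjoint_singleton.2 hlt.ne).mono inter_subset_left inter_subset_left
  calc J.encard + 1 = (insert m J).encard := (encard_insert_of_notMem hmJ).symm
    _ ≤ (K ∪ (S₀ ∪ S₁)).encard := encard_le_encard hcover
    _ ≤ K.encard + (S₀.encard + S₁.encard) :=
      (encard_union_le _ _).trans (by gcongr; exact encard_union_le _ _)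
    _ ≤ K.encard + ({E₀, E₁} ∩ {E | 4 ≤ (A E).trace ^ 2}).encard := by
      rw [insert_eq, union_inter_distrib_right, encard_union_eq hdisj]
      gcongr

theorem encard_components {s : Set ℝ} (hs : s.OrdConnected) :
    {C : Set ℝ | ∃ E ∈ {E | 4 ≤ (A E).trace ^ 2} ∩ s,
      C = connectedComponentIn ({E | 4 ≤ (A E).trace ^ 2} ∩ s) E}.encard =
    {j : ℤ | ∃ E ∈ s, ∃ φ, θ E φ = φ + j * π}.encard := by
  set R : Set ℝ := {E | 4 ≤ (A E).trace ^ 2} with hR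
  set I : ℤ → Set ℝ := fun j => {E ∈ s | ∃ φ, θ E φ = φ + j * π} with hI
  have hIord : ∀ j, (I j).OrdConnected := fun j => by
    refine ⟨?_⟩
    rintro x ⟨hx, φ, hφ⟩ y ⟨hy, ψ, hψ⟩ z hz
    refine ⟨hs.out hx hy hz, ?_⟩
    have i1 := (h.mono_energy φ).monotone hz.1
    have i2 := (h.mono_energy ψ).monotone hz.2
    exact h.exists_eq_of_le_of_le (φ := ψ) (ψ := φ) (by linarith)
      (by linarith)
  have hIR : ∀ j, I j ⊆ R ∩ s := by
    rintro j E ⟨hE, φ, hφ⟩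
    exact ⟨(h.four_le_trace_sq_iff E).2 ⟨φ, j, hφ⟩, hE⟩
  have hcomp : ∀ j, ∀ E ∈ I j, connectedComponentIn (R ∩ s) E = I j := by
    intro j E hE
    refine Subset.antisymm (fun x hx => ?_)
      ((hIord j).isPreconnected.subset_connectedComponentIn hE (hIR j))
    have hxR := connectedComponentIn_subset _ _ hx
    obtain ⟨ψ, i, hi⟩ := (h.four_le_trace_sq_iff x).1 hxR.1
    obtain ⟨hEs, φ, hφ⟩ := hE
    have := h.int_eq_of_isPreconnected isPreconnected_connectedComponentIn
      (fun y hy => (connectedComponentIn_subset _ _ hy).1)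
      (mem_connectedComponentIn (hIR j ⟨hEs, φ, hφ⟩)) hx hφ hi
    exact ⟨hxR.2, ψ, this ▸ hi⟩
  have hinj : InjOn I {j : ℤ | ∃ E ∈ s, ∃ φ, θ E φ = φ + j * π} := by
    rintro i ⟨E, hE, φ, hφ⟩ j - hij
    have hmem : E ∈ I j := hij ▸ ⟨hE, φ, hφ⟩
    obtain ⟨-, ψ, hψ⟩ := hmem
    exact h.int_unique hφ hψ
  rw [← hinj.encard_image]
  congr 1
  ext C
  constructor
  · rintro ⟨E, hE, rfl⟩
    obtain ⟨φ, j, hφ⟩ := (h.four_le_trace_sq_iff E).1 hE.1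
    exact ⟨j, ⟨E, hE.2, φ, hφ⟩, (hcomp j E ⟨hE.2, φ, hφ⟩).symm⟩
  · rintro ⟨j, ⟨E, hE, φ, hφ⟩, rfl⟩
    exact ⟨E, hIR j ⟨hE, φ, hφ⟩, (hcomp j E ⟨hE, φ, hφ⟩).symm⟩

end AngleLift

end GapDirections

section Solutions

open Real Set Filter Topology

theorem LocallyFiniteSet.countable {S : Set ℝ} (hS : LocallyFiniteSet S) : S.Countable := by
  choose U hU hfin using hS
  obtain ⟨t, ht, hcov⟩ := TopologicalSpace.countable_cover_nhds hU
  have : S = ⋃ x ∈ t, S ∩ U x := by rw [← inter_iUnion₂, hcov, inter_univ]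
  rw [this]
  exact ht.biUnion fun x _ => (hfin x).countable

theorem LocallyFiniteSet.isClosed {S : Set ℝ} (hS : LocallyFiniteSet S) : IsClosed S := by
  rw [← isOpen_compl_iff, isOpen_iff_mem_nhds]
  intro x hx
  obtain ⟨U, hU, hfin⟩ := hS x
  filter_upwards [hU, hfin.isClosed.isOpen_compl.mem_nhds fun h => hx h.1] with y hyU hy hyS
  exact hy ⟨hyS, hyU⟩

/-- Boundedness and continuity off a countable set. -/
structure IsRegularPotential (r : ℝ → ℝ) : Prop where
  bdd : ∃ C, ∀ x, |r x| ≤ C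
  cont : ∃ S : Set ℝ, S.Countable ∧ ∀ x ∉ S, ContinuousAt r x

theorem PiecewiseContinuous.isRegularPotential {r : ℝ → ℝ} (hr : PiecewiseContinuous r)
    (hb : ∃ C, ∀ x, |r x| ≤ C) : IsRegularPotential r := by
  obtain ⟨S, hS, hc⟩ := hr
  exact ⟨hb, S, hS.countable, fun x hx => hc.continuousAt (hS.isClosed.isOpen_compl.mem_nhds hx)⟩

namespace IsRegularPotential

variable {r r' : ℝ → ℝ}

theorem sub_const (hr : IsRegularPotential r) (E : ℝ) : IsRegularPotential fun x => r x - E := by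
  obtain ⟨⟨C, hC⟩, S, hS, hc⟩ := hr
  exact ⟨⟨C + |E|, fun x => (abs_sub _ _).trans (by linarith [hC x])⟩, S, hS,
    fun x hx => (hc x hx).sub continuousAt_const⟩

theorem comp_add (hr : IsRegularPotential r) (c : ℝ) : IsRegularPotential fun x => r (x + c) := by
  obtain ⟨⟨C, hC⟩, S, hS, hc⟩ := hr
  refine ⟨⟨C, fun x => hC _⟩, (fun x => x + c) ⁻¹' S, hS.preimage (add_left_injective c),
    fun x hx => ?_⟩
  exact ContinuousAt.comp (f := fun x => x + c) (hc (x + c) hx) (by fun_prop)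

theorem aestronglyMeasurable (hr : IsRegularPotential r) : AEStronglyMeasurable r volume := by
  obtain ⟨-, S, hS, hc⟩ := hr
  have hm : MeasurableSet Sᶜ := hS.measurableSet.compl
  have h1 : ContinuousOn r Sᶜ := fun x hx => (hc x hx).continuousWithinAt
  have h2 := h1.aestronglyMeasurable (μ := volume) hm
  rwa [Measure.restrict_eq_self_of_ae_mem] at h2
  exact hS.ae_notMem volume

theorem intervalIntegrable_mul (hr : IsRegularPotential r) {f : ℝ → ℝ} (hf : Continuous f)
    (a b : ℝ) :
    IntervalIntegrable (fun x => r x * f x) volume a b := by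
  obtain ⟨C, hC⟩ := hr.bdd
  rw [intervalIntegrable_iff]
  exact (intervalIntegrable_iff.1 (hf.intervalIntegrable a b)).bdd_mul
    hr.aestronglyMeasurable.restrict (Eventually.of_forall hC)

end IsRegularPotential

/-- `y` is a solution of `y'' = r y` with derivative `z`. -/
structure IsSol (r y z : ℝ → ℝ) : Prop where
  deriv_fst : ∀ x, HasDerivAt y (z x) x
  cont_snd : Continuous z
  deriv_snd : ∃ S : Set ℝ, S.Countable ∧ ∀ x ∉ S, HasDerivAt z (r x * y x) x

theorem IsRegularPotential.isSol_of_integral_eq {r y z : ℝ → ℝ} (hr : IsRegularPotential r)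
    (hy : ∀ x, HasDerivAt y (z x) x) {z₀ : ℝ} (hz : ∀ x, z x = z₀ + ∫ s in (0 : ℝ)..x, r s * y s) :
    IsSol r y z := by
  have hyc : Continuous y := continuous_iff_continuousAt.2 fun x => (hy x).continuousAt
  have hi := hr.intervalIntegrable_mul hyc
  have hzc : Continuous z := by
    rw [funext hz]
    exact continuous_const.add (intervalIntegral.continuous_primitive hi 0)
  refine ⟨hy, hzc, ?_⟩
  obtain ⟨S, hS, hc⟩ := hr.cont
  refine ⟨S, hS, fun x hx => ?_⟩
  rw [funext hz]
  refine (intervalIntegral.integral_hasDerivAt_right (hi 0 x) ?_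
    ((hc x hx).mul hyc.continuousAt)).const_add z₀
  exact (hr.aestronglyMeasurable.mul hyc.aestronglyMeasurable).stronglyMeasurableAtFilter

namespace IsSol

variable {r r' y z y' z' : ℝ → ℝ}

theorem cont_fst (h : IsSol r y z) : Continuous y :=
  continuous_iff_continuousAt.2 fun x => (h.deriv_fst x).continuousAt

theorem comp_add (h : IsSol r y z) (c : ℝ) :
    IsSol (fun x => r (x + c)) (fun x => y (x + c)) (fun x => z (x + c)) := by
  obtain ⟨S, hS, hz⟩ := h.deriv_snd
  refine ⟨fun x => (h.deriv_fst (x + c)).comp_add_const x c,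
    h.cont_snd.comp (continuous_id.add continuous_const), (fun x => x + c) ⁻¹' S,
    hS.preimage (add_left_injective c), fun x hx => (hz (x + c) hx).comp_add_const x c⟩

theorem wronskian (h : IsSol r y z) (h' : IsSol r' y' z') (hr : IsRegularPotential r)
    (hr' : IsRegularPotential r') (a b : ℝ) :
    (y b * z' b - z b * y' b) - (y a * z' a - z a * y' a) =
      ∫ s in a..b, (r' s - r s) * (y s * y' s) := by
  obtain ⟨S, hS, hz⟩ := h.deriv_snd
  obtain ⟨S', hS', hz'⟩ := h'.deriv_snd
  symm
  refine integral_eq_of_hasDerivAt_off_countable (fun x => y x * z' x - z x * y' x) _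
    (hS.union hS') ?_ ?_ ?_
  · exact ((h.cont_fst.mul h'.cont_snd).sub (h.cont_snd.mul h'.cont_fst)).continuousOn
  · rintro x ⟨-, hx⟩
    rw [mem_union, not_or] at hx
    refine (((h.deriv_fst x).mul (hz' x hx.2)).sub
      ((hz x hx.1).mul (h'.deriv_fst x))).congr_deriv ?_
    ring
  · have hc := h.cont_fst.mul h'.cont_fst
    refine ((hr'.intervalIntegrable_mul hc a b).sub (hr.intervalIntegrable_mul hc a b)).congr ?_
    exact fun x _ => by simp only [Pi.mul_apply]; ring

theorem sq_add_sq_le (h : IsSol r y z) (hr : IsRegularPotential r) {K : ℝ}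
    (hK : ∀ x, |1 + r x| ≤ K) {x : ℝ} (hx : 0 ≤ x) :
    y x ^ 2 + z x ^ 2 ≤ (y 0 ^ 2 + z 0 ^ 2) * exp (K * x) := by
  obtain ⟨S, hS, hz⟩ := h.deriv_snd
  have key := integral_eq_of_hasDerivAt_off_countable
    (fun x => (y x ^ 2 + z x ^ 2) * exp (-(K * x)))
    (fun x => (2 * (1 + r x) * (y x * z x) - K * (y x ^ 2 + z x ^ 2)) * exp (-(K * x)))
    (a := 0) (b := x) hS ?_ ?_ ?_
  · have hle : ∫ s in (0 : ℝ)..x, (2 * (1 + r s) * (y s * z s) - K * (y s ^ 2 + z s ^ 2)) *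
        exp (-(K * s)) ≤ 0 := by
      rw [← neg_nonneg, ← intervalIntegral.integral_neg]
      refine intervalIntegral.integral_nonneg hx fun s _ => neg_nonneg.2 ?_
      refine mul_nonpos_of_nonpos_of_nonneg ?_ (exp_pos _).le
      have h1 := hK s
      rw [abs_le] at h1
      nlinarith [mul_nonneg (sub_nonneg.2 h1.2) (sq_nonneg (y s + z s)),
        mul_nonneg (by linarith [h1.1] : (0 : ℝ) ≤ K + (1 + r s)) (sq_nonneg (y s - z s))]
    rw [key] at hle
    simp only [mul_zero, neg_zero, exp_zero, mul_one] at hle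
    rw [Real.exp_neg, ← div_eq_mul_inv, sub_nonpos, div_le_iff₀ (exp_pos _)] at hle
    exact hle
  · have h1 := h.cont_fst
    have h2 := h.cont_snd
    exact Continuous.continuousOn (by fun_prop)
  · rintro x ⟨-, hx⟩
    have he : HasDerivAt (fun x => exp (-(K * x))) (exp (-(K * x)) * (-(K * 1))) x :=
      (((hasDerivAt_id x).const_mul K).neg).exp
    refine ((((h.deriv_fst x).pow 2).add ((hz x hx).pow 2)).mul he).congr_deriv ?_
    simp only [Pi.add_apply, Pi.pow_apply]
    push_cast
    ring
  · have h1 := h.cont_fst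
    have h2 := h.cont_snd
    have hc1 : Continuous fun x => 2 * (y x * z x) * exp (-(K * x)) := by fun_prop
    have hc2 : Continuous fun x =>
        (2 * (y x * z x) - K * (y x ^ 2 + z x ^ 2)) * exp (-(K * x)) := by
      fun_prop
    refine ((hr.intervalIntegrable_mul hc1 0 x).add (hc2.intervalIntegrable 0 x)).congr ?_
    exact fun x _ => by ring

end IsSol

namespace IsFundamentalSolution

variable {p : ℝ → ℝ} {E : ℝ} {W : ℝ → Matrix (Fin 2) (Fin 2) ℝ} (hW : IsFundamentalSolution p E W)
include hW

theorem apply_zero (i j : Fin 2) : W 0 i j = (1 : Matrix (Fin 2) (Fin 2) ℝ) i j := by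
  simpa using hW.2 0 i j

theorem isSol (hp : IsRegularPotential p) (s c : ℝ) :
    IsSol (fun x => p x - E) (fun x => W x 0 0 * s + W x 0 1 * c)
      (fun x => W x 1 0 * s + W x 1 1 * c) := by
  have hr := hp.sub_const E
  have hcol : ∀ j, IsSol (fun x => p x - E) (fun x => W x 0 j) (fun x => W x 1 j) := by
    intro j
    refine hr.isSol_of_integral_eq (z₀ := (1 : Matrix (Fin 2) (Fin 2) ℝ) 1 j) (fun x => ?_)
      (fun x => ?_)
    · have h0 : (fun x => W x 0 j) = fun x =>
          (1 : Matrix (Fin 2) (Fin 2) ℝ) 0 j + ∫ s in (0 : ℝ)..x, W s 1 j := by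
        funext x
        rw [hW.2 x 0 j]
        congr 1
        refine intervalIntegral.integral_congr fun s _ => ?_
        simp [Matrix.mul_apply, Fin.sum_univ_two]
      rw [h0]
      exact ((hW.1 1 j).integral_hasStrictDerivAt 0 x).hasDerivAt.const_add _
    · rw [hW.2 x 1 j]
      congr 1
      refine intervalIntegral.integral_congr fun s _ => ?_
      simp [Matrix.mul_apply, Fin.sum_univ_two]
  obtain ⟨S, hS, h1⟩ := (hcol 0).deriv_snd
  obtain ⟨T, hT, h2⟩ := (hcol 1).deriv_snd
  refine ⟨fun x => (((hcol 0).deriv_fst x).mul_const s).add (((hcol 1).deriv_fst x).mul_const c),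
    ((hcol 0).cont_snd.mul continuous_const).add ((hcol 1).cont_snd.mul continuous_const), S ∪ T,
    hS.union hT, fun x hx => ?_⟩
  rw [mem_union, not_or] at hx
  refine (((h1 x hx.1).mul_const s).add ((h2 x hx.2).mul_const c)).congr_deriv ?_
  ring

theorem isSol_col_zero (hp : IsRegularPotential p) :
    IsSol (fun x => p x - E) (fun x => W x 0 0) (fun x => W x 1 0) := by
  simpa using hW.isSol hp 1 0

theorem isSol_col_one (hp : IsRegularPotential p) :
    IsSol (fun x => p x - E) (fun x => W x 0 1) (fun x => W x 1 1) := by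
  simpa using hW.isSol hp 0 1

theorem det_eq_one (hp : IsRegularPotential p) (x : ℝ) :
    W x 0 0 * W x 1 1 - W x 0 1 * W x 1 0 = 1 := by
  have hr := hp.sub_const E
  have := (hW.isSol_col_zero hp).wronskian (hW.isSol_col_one hp) hr hr 0 x
  simp only [sub_self, zero_mul, intervalIntegral.integral_zero, hW.apply_zero] at this
  simp at this
  linarith

theorem eq_of_isSol (hp : IsRegularPotential p) {r y z : ℝ → ℝ} (hr : IsRegularPotential r)
    (h : IsSol r y z) {x : ℝ} (hrp : ∀ s ∈ uIoc 0 x, r s = p s - E) :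
    y x = W x 0 0 * y 0 + W x 0 1 * z 0 ∧ z x = W x 1 0 * y 0 + W x 1 1 * z 0 := by
  have hpE := hp.sub_const E
  have hint : ∀ f : ℝ → ℝ, ∫ s in (0 : ℝ)..x, (p s - E - r s) * f s = 0 := by
    intro f
    refine intervalIntegral.integral_zero_ae (ae_of_all _ fun s hs => ?_)
    rw [hrp s hs, sub_self, zero_mul]
  have h0 := h.wronskian (hW.isSol_col_zero hp) hr hpE 0 x
  have h1 := h.wronskian (hW.isSol_col_one hp) hr hpE 0 x
  have hd := hW.det_eq_one hp x
  rw [hint] at h0 h1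
  simp only [hW.apply_zero] at h0 h1
  simp at h0 h1
  constructor
  · linear_combination (-y x) * hd - W x 0 1 * h0 + W x 0 0 * h1
  · linear_combination (-z x) * hd - W x 1 1 * h0 + W x 1 0 * h1

end IsFundamentalSolution

end Solutions

section EnergyDependence

open Real Set Filter Topology

variable {p : ℝ → ℝ} {W : ℝ → ℝ → Matrix (Fin 2) (Fin 2) ℝ}

theorem exists_abs_le_of_isFundamentalSolution (hp : IsRegularPotential p)
    (hW : ∀ E, IsFundamentalSolution p E (W E)) (E X : ℝ) :
    ∃ B, ∀ᶠ E' in 𝓝 E, ∀ x ∈ Icc 0 X, ∀ i j, |W E' x i j| ≤ B := by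
  obtain ⟨C, hC⟩ := hp.bdd
  set K : ℝ := 1 + C + (|E| + 1) with hK
  have hC0 : 0 ≤ C := (abs_nonneg _).trans (hC 0)
  have hK0 : 0 ≤ K := by positivity
  refine ⟨exp (K * X), ?_⟩
  have hev : ∀ᶠ E' in 𝓝 E, |E'| < |E| + 1 :=
    continuous_abs.continuousAt.eventually_lt continuousAt_const (by linarith)
  filter_upwards [hev] with E' hE' x hx i j
  have hr : ∀ x, |1 + (p x - E')| ≤ K := fun x => by
    calc |1 + (p x - E')| ≤ |1| + |p x - E'| := abs_add_le _ _
      _ ≤ |1| + (|p x| + |E'|) := by gcongr; exact abs_sub _ _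
      _ ≤ K := by rw [abs_one]; linarith [hC x]
  have hexp : exp (K * x) ≤ exp (K * X) := exp_le_exp.2 (mul_le_mul_of_nonneg_left hx.2 hK0)
  have h1 : 1 ≤ exp (K * X) := one_le_exp (mul_nonneg hK0 (hx.1.trans hx.2))
  have h0 := ((hW E').isSol_col_zero hp).sq_add_sq_le (hp.sub_const E') hr hx.1
  have h0' := ((hW E').isSol_col_one hp).sq_add_sq_le (hp.sub_const E') hr hx.1
  simp [(hW E').apply_zero] at h0 h0'
  refine abs_le_of_sq_le_sq ?_ (exp_pos _).le
  fin_cases i <;> fin_cases j <;> simp only [Fin.zero_eta, Fin.mk_one, Fin.isValue] <;>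
    nlinarith [sq_nonneg (W E' x 0 0), sq_nonneg (W E' x 0 1), sq_nonneg (W E' x 1 0),
      sq_nonneg (W E' x 1 1)]

theorem exists_lipschitz_of_isFundamentalSolution (hp : IsRegularPotential p)
    (hW : ∀ E, IsFundamentalSolution p E (W E)) (E : ℝ) {X : ℝ} (hX : 0 ≤ X) :
    ∃ L, ∀ᶠ E' in 𝓝 E, ∀ x ∈ Icc 0 X, ∀ i j, |W E' x i j - W E x i j| ≤ L * |E' - E| := by
  obtain ⟨B, hB⟩ := exists_abs_le_of_isFundamentalSolution hp hW E X
  have hB0 := hB.self_of_nhds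
  have hBpos : 0 ≤ B := (abs_nonneg _).trans (hB0 0 ⟨le_rfl, hX⟩ 0 0)
  refine ⟨2 * (B * (B * B * X)), hB.mono fun E' hE' x hx i j => ?_⟩
  have hr := hp.sub_const E
  have hr' := hp.sub_const E'
  have hsol : ∀ E j, IsSol (fun x => p x - E) (fun x => W E x 0 j) (fun x => W E x 1 j) := by
    intro E j
    fin_cases j
    · exact (hW E).isSol_col_zero hp
    · exact (hW E).isSol_col_one hp
  have hint : ∀ k l, |∫ s in (0 : ℝ)..x, (p s - E' - (p s - E)) * (W E s 0 k * W E' s 0 l)| ≤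
      B * B * X * |E' - E| := by
    intro k l
    have hle : ∀ s ∈ uIoc 0 x, ‖(p s - E' - (p s - E)) * (W E s 0 k * W E' s 0 l)‖ ≤
        |E' - E| * (B * B) := by
      intro s hs
      rw [uIoc_of_le hx.1] at hs
      have hs' : s ∈ Icc 0 X := ⟨hs.1.le, hs.2.trans hx.2⟩
      rw [show p s - E' - (p s - E) = -(E' - E) by ring, norm_mul, norm_mul, norm_neg]
      simp only [Real.norm_eq_abs]
      gcongr
      · exact hB0 s hs' 0 k
      · exact hE' s hs' 0 l
    have := intervalIntegral.norm_integral_le_of_norm_le_const hle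
    rw [Real.norm_eq_abs, sub_zero, abs_of_nonneg hx.1] at this
    calc _ ≤ _ := this
      _ ≤ |E' - E| * (B * B) * X := by gcongr; exact hx.2
      _ = _ := by ring
  set I := fun k l => ∫ s in (0 : ℝ)..x, (p s - E' - (p s - E)) * (W E s 0 k * W E' s 0 l) with hI
  have hw : ∀ k l, (W E x 0 k * W E' x 1 l - W E x 1 k * W E' x 0 l) -
      ((1 : Matrix (Fin 2) (Fin 2) ℝ) 0 k * (1 : Matrix (Fin 2) (Fin 2) ℝ) 1 l -
        (1 : Matrix (Fin 2) (Fin 2) ℝ) 1 k * (1 : Matrix (Fin 2) (Fin 2) ℝ) 0 l) = I k l := by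
    intro k l
    have := (hsol E k).wronskian (hsol E' l) hr hr' 0 x
    simp only [(hW E).apply_zero, (hW E').apply_zero] at this
    exact this
  have hd := (hW E).det_eq_one hp x
  have key : W E' x i j - W E x i j = W E x i 1 * I 0 j - W E x i 0 * I 1 j := by
    have e0 := hw 0 j
    have e1 := hw 1 j
    have h01 : ∀ i : Fin 2, i = 0 ∨ i = 1 := by decide
    rcases h01 i with rfl | rfl <;> rcases h01 j with rfl | rfl <;> simp at e0 e1
    · linear_combination (-W E' x 0 0) * hd + W E x 0 1 * e0 - W E x 0 0 * e1
    · linear_combination (-W E' x 0 1) * hd + W E x 0 1 * e0 - W E x 0 0 * e1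
    · linear_combination (-W E' x 1 0) * hd + W E x 1 1 * e0 - W E x 1 0 * e1
    · linear_combination (-W E' x 1 1) * hd + W E x 1 1 * e0 - W E x 1 0 * e1
  rw [key]
  calc |W E x i 1 * I 0 j - W E x i 0 * I 1 j| ≤ |W E x i 1 * I 0 j| + |W E x i 0 * I 1 j| :=
        abs_sub _ _
    _ ≤ B * (B * B * X * |E' - E|) + B * (B * B * X * |E' - E|) := by
        rw [abs_mul, abs_mul]
        gcongr
        · exact hB0 x hx i 1
        · exact hint 0 j
        · exact hB0 x hx i 0
        · exact hint 1 j
    _ = _ := by ring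

theorem continuous_energy_of_isFundamentalSolution (hp : IsRegularPotential p)
    (hW : ∀ E, IsFundamentalSolution p E (W E)) {X : ℝ} (hX : 0 ≤ X) (i j : Fin 2) :
    Continuous fun E => W E X i j := by
  refine continuous_iff_continuousAt.2 fun E => ?_
  obtain ⟨L, hL⟩ := exists_lipschitz_of_isFundamentalSolution hp hW E hX
  refine tendsto_iff_norm_sub_tendsto_zero.2 (squeeze_zero' (Eventually.of_forall fun _ =>
    norm_nonneg _) (hL.mono fun E' h => h X ⟨hX, le_rfl⟩ i j) ?_)
  have : Continuous fun E' => L * |E' - E| := by fun_prop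
  simpa using this.tendsto E

theorem integral_sq_pos_of_isFundamentalSolution (hp : IsRegularPotential p) {E : ℝ}
    {V : ℝ → Matrix (Fin 2) (Fin 2) ℝ} (hV : IsFundamentalSolution p E V) {X : ℝ} (hX : 0 < X)
    (φ : ℝ) : 0 < ∫ x in (0 : ℝ)..X, (V x 0 0 * sin φ + V x 0 1 * cos φ) ^ 2 := by
  have hs := hV.isSol hp (sin φ) (cos φ)
  refine intervalIntegral.integral_pos hX (hs.cont_fst.pow 2).continuousOn
    (fun x _ => sq_nonneg _) ?_
  by_cases h0 : sin φ = 0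
  · have hc : cos φ ≠ 0 := fun hc => by
      have := sin_sq_add_cos_sq φ
      rw [h0, hc] at this
      norm_num at this
    have hd := hs.deriv_fst 0
    have hev := hd.eventually_ne (c := 0) (by simpa [hV.apply_zero] using hc)
    obtain ⟨x, hx, hxm⟩ := ((hev.filter_mono (nhdsGT_le_nhdsNE 0)).and (Ioo_mem_nhdsGT hX)).exists
    exact ⟨x, Ioo_subset_Icc_self hxm, by positivity⟩
  · refine ⟨0, left_mem_Icc.2 hX.le, ?_⟩
    simp only [hV.apply_zero]
    simp
    positivity

theorem isRotating_of_isFundamentalSolution (hp : IsRegularPotential p)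
    (hW : ∀ E, IsFundamentalSolution p E (W E)) {X : ℝ} (hX : 0 < X) :
    IsRotating fun E => W E X := by
  refine ⟨continuous_energy_of_isFundamentalSolution hp hW hX.le, fun E => (hW E).det_eq_one hp X,
    fun E φ => ?_⟩
  obtain ⟨B, hB⟩ := exists_abs_le_of_isFundamentalSolution hp hW E X
  set y : ℝ → ℝ → ℝ := fun E x => W E x 0 0 * sin φ + W E x 0 1 * cos φ with hy
  set z : ℝ → ℝ → ℝ := fun E x => W E x 1 0 * sin φ + W E x 1 1 * cos φ with hz
  have hsol : ∀ E, IsSol (fun x => p x - E) (y E) (z E) := fun E => (hW E).isSol hp _ _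
  have hyB : ∀ᶠ E' in 𝓝 E, ∀ x ∈ Icc 0 X, |y E' x| ≤ 2 * B := by
    filter_upwards [hB] with E' hE' x hx
    have h1 := hE' x hx 0 0
    have h2 := hE' x hx 0 1
    have hB0 := (abs_nonneg _).trans h1
    calc |y E' x| ≤ |W E' x 0 0 * sin φ| + |W E' x 0 1 * cos φ| := abs_add_le _ _
      _ ≤ B * 1 + B * 1 := by
        rw [abs_mul, abs_mul]
        gcongr
        · exact abs_sin_le_one φ
        · exact abs_cos_le_one φ
      _ = _ := by ring
  have ht : Tendsto (fun E' => ∫ x in (0 : ℝ)..X, y E x * y E' x) (𝓝 E)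
      (𝓝 (∫ x in (0 : ℝ)..X, y E x * y E x)) := by
    refine intervalIntegral.tendsto_integral_filter_of_dominated_convergence
      (fun _ => 2 * B * (2 * B)) ?_ ?_ intervalIntegrable_const ?_
    · exact Eventually.of_forall fun E' =>
        ((hsol E).cont_fst.mul (hsol E').cont_fst).aestronglyMeasurable
    · filter_upwards [hyB] with E' hE'
      refine ae_of_all _ fun x hx => ?_
      rw [uIoc_of_le hX.le] at hx
      have hx' : x ∈ Icc 0 X := ⟨hx.1.le, hx.2⟩
      have h0 := hyB.self_of_nhds x hx'
      rw [norm_mul, Real.norm_eq_abs, Real.norm_eq_abs]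
      exact mul_le_mul h0 (hE' x hx') (abs_nonneg _) ((abs_nonneg _).trans h0)
    · refine ae_of_all _ fun x hx => ?_
      rw [uIoc_of_le hX.le] at hx
      have hc := fun j => (continuous_energy_of_isFundamentalSolution hp hW hx.1.le 0 j).tendsto E
      exact (((hc 0).mul_const _).add ((hc 1).mul_const _)).const_mul _
  have hpos : 0 < ∫ x in (0 : ℝ)..X, y E x * y E x := by
    simpa only [sq] using integral_sq_pos_of_isFundamentalSolution hp (hW E) hX φ
  filter_upwards [nhdsWithin_le_nhds (ht.eventually (lt_mem_nhds hpos)), self_mem_nhdsWithin]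
    with E' hE' hlt
  have hw := (hsol E).wronskian (hsol E') (hp.sub_const E) (hp.sub_const E') 0 X
  have h0 : y E 0 * z E' 0 - z E 0 * y E' 0 = 0 := by
    simp only [hy, hz, (hW E).apply_zero, (hW E').apply_zero]
    ring
  rw [h0, sub_zero] at hw
  have hc : ∫ s in (0 : ℝ)..X, (p s - E' - (p s - E)) * (y E s * y E' s) =
      (E - E') * ∫ s in (0 : ℝ)..X, y E s * y E' s := by
    rw [← intervalIntegral.integral_const_mul]
    exact intervalIntegral.integral_congr fun s _ => by ring
  rw [hc] at hw
  change 0 < y E' X * z E X - z E' X * y E X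
  have : 0 < (E' - E) * ∫ s in (0 : ℝ)..X, y E s * y E' s := mul_pos (sub_pos.2 hlt) hE'
  linarith

end EnergyDependence

section GeometricGrowth

open Real Set Filter Topology

theorem eq_zero_of_integrableOn_of_add_eq_mul {h : ℝ → ℝ} {a l : ℝ} (ha : 0 < a) (hl : 1 < l)
    (hc : Continuous h) (h0 : ∀ x, 0 ≤ h x) (hi : IntegrableOn h (Ioi 0))
    (hmul : ∀ x, 0 < x → h (x + a) = l * h x) {x : ℝ} (hx : 0 < x) : h x = 0 := by
  have hshift : ∫ x in Ioi a, h x = l * ∫ x in Ioi 0, h x := by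
    rw [← (measurePreserving_add_right volume a).setIntegral_preimage_emb
      (measurableEmbedding_addRight a) h (Ioi a), ← integral_const_mul]
    have hs : (fun x => x + a) ⁻¹' Ioi a = Ioi 0 := by ext x; simp
    rw [hs]
    exact setIntegral_congr_fun measurableSet_Ioi fun x hx => hmul x hx
  have hle : ∫ x in Ioi a, h x ≤ ∫ x in Ioi 0, h x :=
    setIntegral_mono_set hi (ae_of_all _ h0) (ae_of_all _ (Ioi_subset_Ioi ha.le))
  have hnn : 0 ≤ ∫ x in Ioi 0, h x := setIntegral_nonneg measurableSet_Ioi fun x _ => h0 x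
  have hz : ∫ x in Ioi 0, h x = 0 := by nlinarith
  rw [setIntegral_eq_zero_iff_of_nonneg_ae (ae_of_all _ h0) hi] at hz
  exact Measure.eqOn_open_of_ae_eq hz isOpen_Ioi hc.continuousOn continuousOn_const hx

theorem integrableOn_Ioi_of_add_eq_mul {h : ℝ → ℝ} {a b l : ℝ} (ha : 0 < a) (hl0 : 0 ≤ l)
    (hl : l < 1) (hc : Continuous h) (h0 : ∀ x, 0 ≤ h x)
    (hmul : ∀ x, b ≤ x → h (x + a) = l * h x) : IntegrableOn h (Ioi b) := by
  have hii : ∀ u v, IntervalIntegrable h volume u v := fun u v => hc.intervalIntegrable u v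
  have hstep : ∀ n : ℕ, ∫ x in b + n * a..b + (n + 1) * a, h x = l ^ n * ∫ x in b..b + a, h x := by
    intro n
    induction n with
    | zero => simp
    | succ n ih =>
      rw [pow_succ', mul_assoc, ← ih, ← intervalIntegral.integral_const_mul]
      have hx : ∀ x ∈ uIcc (b + n * a) (b + (n + 1) * a), l * h x = h (x + a) := by
        intro x hx
        rw [uIcc_of_le (by nlinarith)] at hx
        exact (hmul x (by nlinarith [hx.1, n.cast_nonneg (α := ℝ)])).symm
      rw [intervalIntegral.integral_congr hx, intervalIntegral.integral_comp_add_right]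
      congr 1 <;> push_cast <;> ring
  have hsum : ∀ n : ℕ, ∫ x in b..b + n * a, h x =
      (∑ i ∈ Finset.range n, l ^ i) * ∫ x in b..b + a, h x := by
    intro n
    induction n with
    | zero => simp
    | succ n ih =>
      rw [Finset.sum_range_succ, add_mul, ← ih, ← hstep,
        ← intervalIntegral.integral_add_adjacent_intervals (hii b (b + n * a)) (hii _ _)]
      push_cast
      rfl
  refine integrableOn_Ioi_of_intervalIntegral_norm_bounded (l := atTop)
    (b := fun n : ℕ => b + n * a) ((1 - l)⁻¹ * ∫ x in b..b + a, h x) b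
    (fun n => hc.integrableOn_Ioc) ?_ (Eventually.of_forall fun n => ?_)
  · exact tendsto_atTop_add_const_left _ _ (tendsto_natCast_atTop_atTop.atTop_mul_const ha)
  · simp only [Real.norm_of_nonneg (h0 _)]
    rw [hsum]
    refine mul_le_mul_of_nonneg_right ?_
      (intervalIntegral.integral_nonneg (by linarith) fun x _ => h0 x)
    rw [← tsum_geometric_of_lt_one hl0 hl]
    exact (summable_geometric_of_lt_one hl0 hl).sum_le_tsum _ fun i _ => pow_nonneg hl0 i

/-- A square integrable combination of a growing and a decaying Floquet solution has no growing
part. -/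
theorem growing_coeff_eq_zero {y f g : ℝ → ℝ} {a c d S T : ℝ} (ha : 0 < a) (hc : 1 < c ^ 2)
    (hy : Continuous y) (hf : Continuous f) (hyi : Integrable fun x => y x ^ 2)
    (hfm : ∀ x, f (x + a) = c * f x) (hgm : ∀ x, g (x + a) = c⁻¹ * g x)
    (hrep : ∀ x, 0 ≤ x → d * y x = S * f x + T * g x) (hne : ∃ x, 0 < x ∧ f x ≠ 0) : S = 0 := by
  obtain ⟨x₀, hx₀, hfx⟩ := hne
  have hc0 : c ≠ 0 := by rintro rfl; norm_num at hc
  have hcc : c - c⁻¹ ≠ 0 := by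
    intro h
    have : c ^ 2 = 1 := by
      rw [sub_eq_zero] at h
      field_simp at h
      exact h
    linarith
  have hyi' : Integrable fun x => y (x + a) ^ 2 := hyi.comp_add_right a
  have hw : Integrable fun x => (d * (y (x + a) - c⁻¹ * y x)) ^ 2 := by
    refine (((hyi'.const_mul (2 * d ^ 2)).add (hyi.const_mul (2 * (d * c⁻¹) ^ 2)))).mono'
      (Continuous.aestronglyMeasurable (by fun_prop)) (ae_of_all _ fun x => ?_)
    rw [Real.norm_of_nonneg (sq_nonneg _)]
    simp only [Pi.add_apply]
    nlinarith [sq_nonneg (d * (y (x + a) + c⁻¹ * y x))]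
  have hSf : IntegrableOn (fun x => (S * (c - c⁻¹) * f x) ^ 2) (Ioi 0) := by
    refine hw.integrableOn.congr_fun (fun x hx => ?_) measurableSet_Ioi
    have h1 := hrep x (le_of_lt hx)
    have h2 := hrep (x + a) (add_pos hx ha).le
    rw [hfm, hgm] at h2
    simp only
    congr 1
    linear_combination h2 - c⁻¹ * h1
  have := eq_zero_of_integrableOn_of_add_eq_mul ha hc (by fun_prop) (fun x => sq_nonneg _) hSf
    (fun x _ => by rw [hfm]; ring) hx₀
  simpa [hcc, hfx] using this

end GeometricGrowth

section Gluing

open Real Set Filter Topology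

theorem IsRegularPotential.glue {r r' : ℝ → ℝ} (hr : IsRegularPotential r)
    (hr' : IsRegularPotential r') (b : ℝ) :
    IsRegularPotential fun x => if x ≤ b then r x else r' x := by
  obtain ⟨⟨C, hC⟩, S, hS, hc⟩ := hr
  obtain ⟨⟨C', hC'⟩, S', hS', hc'⟩ := hr'
  refine ⟨⟨max C C', fun x => ?_⟩, S ∪ S' ∪ {b}, (hS.union hS').union (countable_singleton b),
    fun x hx => ?_⟩
  · split_ifs
    exacts [(hC x).trans (le_max_left _ _), (hC' x).trans (le_max_right _ _)]
  · simp only [mem_union, mem_singleton_iff, not_or] at hx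
    rcases lt_or_gt_of_ne hx.2 with h | h
    · refine (hc x hx.1.1).congr ?_
      filter_upwards [Iio_mem_nhds h] with s hs
      rw [if_pos (le_of_lt hs)]
    · refine (hc' x hx.1.2).congr ?_
      filter_upwards [Ioi_mem_nhds h] with s hs
      rw [if_neg (not_le_of_gt hs)]

namespace IsSol

variable {r r' y z y' z' : ℝ → ℝ}

theorem glue {b : ℝ} (h : IsSol r y z) (h' : IsSol r' y' z') (hy : y b = y' b) (hz : z b = z' b) :
    IsSol (fun x => if x ≤ b then r x else r' x) (fun x => if x ≤ b then y x else y' x)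
      (fun x => if x ≤ b then z x else z' x) := by
  obtain ⟨S, hS, hd⟩ := h.deriv_snd
  obtain ⟨S', hS', hd'⟩ := h'.deriv_snd
  have left : ∀ (f g : ℝ → ℝ) {x : ℝ}, x < b →
      (fun x => if x ≤ b then f x else g x) =ᶠ[𝓝 x] f := fun f g x hx => by
    filter_upwards [Iio_mem_nhds hx] with s hs
    rw [if_pos (le_of_lt hs)]
  have right : ∀ (f g : ℝ → ℝ) {x : ℝ}, b < x →
      (fun x => if x ≤ b then f x else g x) =ᶠ[𝓝 x] g := fun f g x hx => by
    filter_upwards [Ioi_mem_nhds hx] with s hs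
    rw [if_neg (not_le_of_gt hs)]
  refine ⟨fun x => ?_, ?_, S ∪ S' ∪ {b}, (hS.union hS').union (countable_singleton b),
    fun x hx => ?_⟩
  · rcases lt_trichotomy x b with hx | rfl | hx
    · rw [if_pos hx.le]
      exact (h.deriv_fst x).congr_of_eventuallyEq (left y y' hx)
    · rw [if_pos le_rfl, ← hasDerivWithinAt_univ, ← Iic_union_Ici (a := x)]
      refine HasDerivWithinAt.union ?_ ?_
      · exact (h.deriv_fst x).hasDerivWithinAt.congr (fun s hs => if_pos hs) (if_pos le_rfl)
      · have h1 := (h'.deriv_fst x).hasDerivWithinAt (s := Ici x)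
        rw [← hz] at h1
        refine h1.congr (fun s hs => ?_) (by rw [if_pos le_rfl, hy])
        rcases eq_or_lt_of_le (mem_Ici.1 hs) with rfl | hs
        · rw [if_pos le_rfl, hy]
        · rw [if_neg (not_le_of_gt hs)]
    · rw [if_neg (not_le_of_gt hx)]
      exact (h'.deriv_fst x).congr_of_eventuallyEq (right y y' hx)
  · exact Continuous.if_le h.cont_snd h'.cont_snd continuous_id continuous_const
      fun x (hx : x = b) => by rw [hx, hz]
  · simp only [mem_union, mem_singleton_iff, not_or] at hx
    rcases lt_or_gt_of_ne hx.2 with hb | hb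
    · simp only [if_pos hb.le]
      exact (hd x hx.1.1).congr_of_eventuallyEq (left z z' hb)
    · simp only [if_neg (not_le_of_gt hb)]
      exact (hd' x hx.1.2).congr_of_eventuallyEq (right z z' hb)

theorem congr {T : Set ℝ} (h : IsSol r y z) (hT : T.Countable) (hrr : ∀ x ∉ T, r x = r' x) :
    IsSol r' y z := by
  obtain ⟨S, hS, hd⟩ := h.deriv_snd
  refine ⟨h.deriv_fst, h.cont_snd, S ∪ T, hS.union hT, fun x hx => ?_⟩
  rw [mem_union, not_or] at hx
  rw [← hrr x hx.2]
  exact hd x hx.1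

theorem const_mul (h : IsSol r y z) (m : ℝ) : IsSol r (fun x => m * y x) (fun x => m * z x) := by
  obtain ⟨S, hS, hd⟩ := h.deriv_snd
  exact ⟨fun x => (h.deriv_fst x).const_mul m, h.cont_snd.const_mul m, S, hS,
    fun x hx => ((hd x hx).const_mul m).congr_deriv (by ring)⟩

theorem integral_eq (h : IsSol r y z) (hr : IsRegularPotential r) (x : ℝ) :
    z x = z 0 + ∫ s in (0 : ℝ)..x, r s * y s := by
  obtain ⟨S, hS, hd⟩ := h.deriv_snd
  rw [integral_eq_of_hasDerivAt_off_countable z _ hS h.cont_snd.continuousOn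
    (fun s hs => hd s hs.2) (hr.intervalIntegrable_mul h.cont_fst 0 x)]
  ring

end IsSol

theorem isDefectEigenvalue_iff_isSol {q p : ℝ → ℝ} {E : ℝ} {T : Set ℝ} (hp : IsRegularPotential p)
    (hT : T.Countable) (hpq : ∀ x ∉ T, p x = q x) :
    IsDefectEigenvalue q E ↔ ∃ u v : ℝ → ℝ, IsSol (fun x => p x - E) u v ∧ u ≠ 0 ∧
      Integrable fun x => u x ^ 2 := by
  have hint : ∀ (u : ℝ → ℝ) (x : ℝ),
      ∫ s in (0 : ℝ)..x, (q s - E) * u s = ∫ s in (0 : ℝ)..x, (p s - E) * u s := by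
    intro u x
    refine intervalIntegral.integral_congr_ae ?_
    filter_upwards [hT.ae_notMem volume] with s hs _
    rw [hpq s hs]
  constructor
  · rintro ⟨u, hu, hne, hi, hd⟩
    exact ⟨u, deriv u, (hp.sub_const E).isSol_of_integral_eq (fun x => (hu x).hasDerivAt)
      fun x => (hd x).trans (by rw [hint]), hne, hi⟩
  · rintro ⟨u, v, hs, hne, hi⟩
    refine ⟨u, fun x => (hs.deriv_fst x).differentiableAt, hne, hi, fun x => ?_⟩
    rw [(hs.deriv_fst x).deriv, (hs.deriv_fst 0).deriv, hint, hs.integral_eq (hp.sub_const E) x]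

end Gluing

section Floquet

open Real Set Filter Topology

variable {p : ℝ → ℝ} {E a c φ : ℝ} {V : ℝ → Matrix (Fin 2) (Fin 2) ℝ}

theorem IsFundamentalSolution.add_period (hV : IsFundamentalSolution p E V)
    (hp : IsRegularPotential p) (hper : ∀ x, p (x + a) = p x) (hφ : IsEigenAngle (V a) c φ)
    (x : ℝ) : V (x + a) 0 0 * sin φ + V (x + a) 0 1 * cos φ =
      c * (V x 0 0 * sin φ + V x 0 1 * cos φ) := by
  have hs := (hV.isSol hp (sin φ) (cos φ)).comp_add a
  have h := (hV.eq_of_isSol hp ((hp.sub_const E).comp_add a) hs (x := x)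
    fun s _ => by rw [hper]).1
  simp only [zero_add] at h
  rw [h, hφ.1, hφ.2]
  ring

theorem IsFundamentalSolution.exists_mem_Ioc_ne_zero (hV : IsFundamentalSolution p E V)
    (hp : IsRegularPotential p) (hper : ∀ x, p (x + a) = p x) (hφ : IsEigenAngle (V a) c φ)
    (ha : 0 < a) (hc : c ≠ 0) (b : ℝ) :
    ∃ x ∈ Ioc b (b + a), V x 0 0 * sin φ + V x 0 1 * cos φ ≠ 0 := by
  have hpe : Function.Periodic (fun x => V x 0 0 * sin φ + V x 0 1 * cos φ = 0) a := fun x => by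
    simp only [hV.add_period hp hper hφ, mul_eq_zero, hc, false_or]
  by_contra! h
  have hpos := integral_sq_pos_of_isFundamentalSolution hp hV ha φ
  refine hpos.ne' (intervalIntegral.integral_zero_ae (ae_of_all _ fun x _ => ?_))
  obtain ⟨x', hx', he⟩ := hpe.exists_mem_Ioc ha x b
  have : V x 0 0 * sin φ + V x 0 1 * cos φ = 0 := he.mpr (h x' hx')
  rw [this, zero_pow two_ne_zero]

end Floquet

section DefectEigenvalue

open Real Set Filter Topology

variable {a E c α β : ℝ} {q_per q_def : ℝ → ℝ} {V W : ℝ → Matrix (Fin 2) (Fin 2) ℝ}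

/-- The potential with the defect inserted into `(0, 1]`. -/
noncomputable def defectPotential (q_per q_def : ℝ → ℝ) (x : ℝ) : ℝ :=
  if x ≤ 0 then q_per x else if x ≤ 1 then q_def x else q_per (x + -1)

theorem isRegularPotential_defectPotential (hp : IsRegularPotential q_per)
    (hd : IsRegularPotential q_def) : IsRegularPotential (defectPotential q_per q_def) :=
  hp.glue (hd.glue (hp.comp_add (-1)) 1) 0

theorem bracket_eq_zero_of_isSol (ha : 0 < a) (hp : IsRegularPotential q_per)
    (hd : IsRegularPotential q_def) (hper : ∀ x, q_per (x + a) = q_per x)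
    (hV : IsFundamentalSolution q_per E V) (hW : IsFundamentalSolution q_def E W)
    (hc : 1 < c ^ 2) (hα : IsEigenAngle (V a) c α) (hβ : IsEigenAngle (V a) c⁻¹ β)
    {u v : ℝ → ℝ} (hs : IsSol (fun x => defectPotential q_per q_def x - E) u v) (hne : u ≠ 0)
    (hi : Integrable fun x => u x ^ 2) :
    (W 1 0 0 * sin α + W 1 0 1 * cos α) * cos β -
      (W 1 1 0 * sin α + W 1 1 1 * cos α) * sin β = 0 := by
  have hr := (isRegularPotential_defectPotential hp hd).sub_const E
  have hc0 : c ≠ 0 := by rintro rfl; norm_num at hc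
  have hl : ∀ x ≤ 0, u x = V x 0 0 * u 0 + V x 0 1 * v 0 := fun x hx =>
    (hV.eq_of_isSol hp hr hs fun s h => by
      rw [uIoc_of_ge hx] at h
      rw [defectPotential, if_pos h.2]).1
  have hm : ∀ x ∈ Icc (0 : ℝ) 1, u x = W x 0 0 * u 0 + W x 0 1 * v 0 ∧
      v x = W x 1 0 * u 0 + W x 1 1 * v 0 := fun x hx =>
    hW.eq_of_isSol hd hr hs fun s h => by
      rw [uIoc_of_le hx.1] at h
      rw [defectPotential, if_neg (not_le_of_gt h.1), if_pos (h.2.trans hx.2)]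
  have hrt : ∀ x, 0 ≤ x → u (x + 1) = V x 0 0 * u 1 + V x 0 1 * v 1 := fun x hx => by
    have := (hV.eq_of_isSol hp (hr.comp_add 1) (hs.comp_add 1) (x := x) fun s h => by
      rw [uIoc_of_le hx] at h
      have h0 := h.1
      rw [defectPotential, if_neg (by linarith), if_neg (by linarith), add_neg_cancel_right]).1
    simpa only [zero_add] using this
  have hfα := (hV.isSol hp (sin α) (cos α)).cont_fst
  have hfβ := (hV.isSol hp (sin β) (cos β)).cont_fst
  have hpα := hV.add_period hp hper hα
  have hpβ := hV.add_period hp hper hβ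
  have hleft : -(u 0 * cos α - v 0 * sin α) = 0 := by
    refine growing_coeff_eq_zero (y := fun x => u (-x)) (d := sin α * cos β - cos α * sin β)
      (f := fun x => V (-x) 0 0 * sin β + V (-x) 0 1 * cos β)
      (g := fun x => V (-x) 0 0 * sin α + V (-x) 0 1 * cos α)
      (T := u 0 * cos β - v 0 * sin β) ha hc (hs.cont_fst.comp continuous_neg)
      (hfβ.comp continuous_neg) hi.comp_neg (fun x => ?_) (fun x => ?_) (fun x hx => ?_) ?_
    · have := hpβ (-(x + a))
      rw [show -(x + a) + a = -x by ring] at this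
      rw [this, mul_inv_cancel_left₀ hc0]
    · have := hpα (-(x + a))
      rw [show -(x + a) + a = -x by ring] at this
      rw [this, inv_mul_cancel_left₀ hc0]
    · rw [hl (-x) (by linarith)]
      ring
    · obtain ⟨x, hx, h⟩ := hV.exists_mem_Ioc_ne_zero hp hper hβ ha (inv_ne_zero hc0) (-a - a)
      refine ⟨-x, by linarith [hx.2], ?_⟩
      rwa [neg_neg]
  have hright : u 1 * cos β - v 1 * sin β = 0 := by
    refine growing_coeff_eq_zero (y := fun x => u (x + 1)) (d := sin α * cos β - cos α * sin β)
      (f := fun x => V x 0 0 * sin α + V x 0 1 * cos α)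
      (g := fun x => V x 0 0 * sin β + V x 0 1 * cos β)
      (T := -(u 1 * cos α - v 1 * sin α)) ha hc (hs.comp_add 1).cont_fst
      hfα (hi.comp_add_right 1) hpα hpβ (fun x hx => ?_) ?_
    · rw [hrt x hx]
      ring
    · obtain ⟨x, hx, h⟩ := hV.exists_mem_Ioc_ne_zero hp hper hα ha hc0 0
      exact ⟨x, hx.1, h⟩
  have hsα := sin_sq_add_cos_sq α
  set k := u 0 * sin α + v 0 * cos α with hk
  have hu0 : u 0 = k * sin α := by linear_combination (-cos α) * hleft - u 0 * hsα
  have hv0 : v 0 = k * cos α := by linear_combination sin α * hleft - v 0 * hsα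
  obtain ⟨hu1, hv1⟩ := hm 1 ⟨zero_le_one, le_rfl⟩
  have hk0 : k ≠ 0 := by
    intro hk0
    rw [hk0, zero_mul] at hu0 hv0
    rw [hu0, hv0, mul_zero, mul_zero, add_zero] at hu1 hv1
    refine hne (funext fun x => ?_)
    rw [Pi.zero_apply]
    rcases le_total x 0 with hx | hx
    · rw [hl x hx, hu0, hv0, mul_zero, mul_zero, add_zero]
    rcases le_total x 1 with hx1 | hx1
    · rw [(hm x ⟨hx, hx1⟩).1, hu0, hv0, mul_zero, mul_zero, add_zero]
    · have := hrt (x - 1) (by linarith)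
      rwa [sub_add_cancel, hu1, hv1, mul_zero, mul_zero, add_zero] at this
  refine (mul_eq_zero.1 ?_).resolve_left hk0
  rw [hu1, hv1] at hright
  linear_combination hright - (W 1 0 0 * cos β - W 1 1 0 * sin β) * hu0 -
    (W 1 0 1 * cos β - W 1 1 1 * sin β) * hv0

theorem exists_isSol_of_bracket_eq_zero (ha : 0 < a) (hp : IsRegularPotential q_per)
    (hd : IsRegularPotential q_def) (hper : ∀ x, q_per (x + a) = q_per x)
    (hV : IsFundamentalSolution q_per E V) (hW : IsFundamentalSolution q_def E W)
    (hc : 1 < c ^ 2) (hα : IsEigenAngle (V a) c α) (hβ : IsEigenAngle (V a) c⁻¹ β)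
    (hbr : (W 1 0 0 * sin α + W 1 0 1 * cos α) * cos β -
      (W 1 1 0 * sin α + W 1 1 1 * cos α) * sin β = 0) :
    ∃ u v : ℝ → ℝ, IsSol (fun x => defectPotential q_per q_def x - E) u v ∧ u ≠ 0 ∧
      Integrable fun x => u x ^ 2 := by
  have hc0 : c ≠ 0 := by rintro rfl; norm_num at hc
  have hsβ := sin_sq_add_cos_sq β
  set w₀ := W 1 0 0 * sin α + W 1 0 1 * cos α with hw₀
  set w₁ := W 1 1 0 * sin α + W 1 1 1 * cos α with hw₁
  set m := w₀ * sin β + w₁ * cos β with hm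
  have e0 : w₀ = m * sin β := by linear_combination cos β * hbr - w₀ * hsβ
  have e1 : w₁ = m * cos β := by linear_combination (-sin β) * hbr - w₁ * hsβ
  have hR := ((hV.isSol hp (sin β) (cos β)).const_mul m).comp_add (-1)
  have hMR := (hW.isSol hd (sin α) (cos α)).glue hR (b := 1)
    (by simp [hV.apply_zero, ← e0, ← hw₀]) (by simp [hV.apply_zero, ← e1, ← hw₁])
  have hs := (hV.isSol hp (sin α) (cos α)).glue hMR (b := 0)
    (by simp [hV.apply_zero, hW.apply_zero]) (by simp [hV.apply_zero, hW.apply_zero])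
  have hpα := hV.add_period hp hper hα
  have hpβ := hV.add_period hp hper hβ
  have hlt : (c⁻¹) ^ 2 < 1 := by rw [inv_pow]; exact inv_lt_one_of_one_lt₀ hc
  refine ⟨_, _, hs.congr countable_empty fun x _ => ?_, fun h => ?_, ?_⟩
  · simp only [defectPotential]
    split_ifs <;> rfl
  · obtain ⟨x, hx, hne⟩ := hV.exists_mem_Ioc_ne_zero hp hper hα ha hc0 (-a)
    have := congrFun h x
    simp only [if_pos (show x ≤ 0 by linarith [hx.2])] at this
    exact hne this
  · have hcont := hs.cont_fst
    set u : ℝ → ℝ := fun x => if x ≤ 0 then V x 0 0 * sin α + V x 0 1 * cos α else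
      if x ≤ 1 then W x 0 0 * sin α + W x 0 1 * cos α else
        m * (V (x + -1) 0 0 * sin β + V (x + -1) 0 1 * cos β) with hu
    have hul : ∀ x ≤ 0, u x = V x 0 0 * sin α + V x 0 1 * cos α := fun x hx => if_pos hx
    have hu1 : u 1 = m * sin β := by
      simp [hu, ← e0, ← hw₀]
    have hur : ∀ x, 1 ≤ x → u x = m * (V (x + -1) 0 0 * sin β + V (x + -1) 0 1 * cos β) := by
      intro x hx
      rcases hx.eq_or_lt with rfl | hx
      · rw [hu1]
        simp [hV.apply_zero]
      · simp only [hu]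
        rw [if_neg (by linarith), if_neg (by linarith)]
    have hR : IntegrableOn (fun x => u x ^ 2) (Ioi 1) := by
      refine integrableOn_Ioi_of_add_eq_mul ha (sq_nonneg c⁻¹) hlt (hcont.pow 2)
        (fun x => sq_nonneg _) fun x hx => ?_
      rw [hur x hx, hur (x + a) (by linarith), show x + a + -1 = x + -1 + a by ring, hpβ]
      ring
    have hL : IntegrableOn (fun x => u (-x) ^ 2) (Ioi 0) := by
      refine integrableOn_Ioi_of_add_eq_mul ha (sq_nonneg c⁻¹) hlt
        ((hcont.comp continuous_neg).pow 2) (fun x => sq_nonneg _) fun x hx => ?_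
      have h := hpα (-(x + a))
      rw [show -(x + a) + a = -x by ring] at h
      rw [hul (-x) (by linarith), hul (-(x + a)) (by linarith), h, ← mul_pow,
        inv_mul_cancel_left₀ hc0]
    have hL' : IntegrableOn (fun x => u x ^ 2) (Iio 0) := by
      have h := hL
      rw [← neg_zero] at h
      simpa using h.comp_neg_Iio
    have hM : IntegrableOn (fun x => u x ^ 2) (Icc 0 1) := (hcont.pow 2).integrableOn_Icc
    rw [← integrableOn_univ]
    refine ((hL'.union hM).union hR).mono_set fun x _ => ?_
    simp only [mem_union, mem_Iio, mem_Icc, mem_Ioi]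
    rcases lt_or_ge x 0 with h | h
    · exact Or.inl (Or.inl h)
    · rcases le_or_gt x 1 with h' | h'
      exacts [Or.inl (Or.inr ⟨h, h'⟩), Or.inr h']

theorem isDefectEigenvalue_iff_bracket_eq_zero (ha : 0 < a) (hp : IsRegularPotential q_per)
    (hd : IsRegularPotential q_def) (hper : ∀ x, q_per (x + a) = q_per x)
    (hV : IsFundamentalSolution q_per E V) (hW : IsFundamentalSolution q_def E W) {q : ℝ → ℝ}
    (hq : ∀ x, q x = if x ≤ 0 then q_per x else if x < 1 then q_def x else q_per (x - 1))
    (hc : 1 < c ^ 2) (hα : IsEigenAngle (V a) c α) (hβ : IsEigenAngle (V a) c⁻¹ β) :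
    IsDefectEigenvalue q E ↔ (W 1 0 0 * sin α + W 1 0 1 * cos α) * cos β -
      (W 1 1 0 * sin α + W 1 1 1 * cos α) * sin β = 0 := by
  rw [isDefectEigenvalue_iff_isSol (isRegularPotential_defectPotential hp hd)
    (countable_singleton 1) fun x hx => ?_]
  · exact ⟨fun ⟨u, v, hs, hne, hi⟩ =>
      bracket_eq_zero_of_isSol ha hp hd hper hV hW hc hα hβ hs hne hi,
      exists_isSol_of_bracket_eq_zero ha hp hd hper hV hW hc hα hβ⟩
  · rw [hq, defectPotential, ← sub_eq_add_neg]
    simp only [(show x ≠ 1 from hx).le_iff_lt]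

end DefectEigenvalue

section Gap

open Real Set Filter Topology

theorem IsGap.exists_eq_Ioo {k : ℝ → ℝ} (hk : Continuous k) {G : Set ℝ} (hG : IsGap k G) :
    ∃ E₀ E₁, E₀ < E₁ ∧ G = Ioo E₀ E₁ ∧ k E₀ ^ 2 = 4 ∧ k E₁ ^ 2 = 4 ∧ ∀ E ∈ G, 4 < k E ^ 2 := by
  obtain ⟨hbd, E, hE, hGE⟩ := hG
  set O : Set ℝ := {E : ℝ | k E ^ 2 > 4} with hO
  have hOo : IsOpen O := isOpen_lt continuous_const (hk.pow 2)
  have hGo : IsOpen G := hGE ▸ hOo.connectedComponentIn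
  have hEG : E ∈ G := hGE ▸ mem_connectedComponentIn hE
  have hGO : G ⊆ O := hGE ▸ connectedComponentIn_subset O E
  have hconn : IsConnected G := ⟨⟨E, hEG⟩, hGE ▸ isPreconnected_connectedComponentIn⟩
  have hIoo : G = Ioo (sInf G) (sSup G) := by
    refine Subset.antisymm (fun x hx => ?_)
      (hconn.Ioo_csInf_csSup_subset hbd.bddBelow hbd.bddAbove)
    obtain ⟨l, u, hlu, hsub⟩ := mem_nhds_iff_exists_Ioo_subset.1 (hGo.mem_nhds hx)
    obtain ⟨y, hy⟩ := exists_between hlu.1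
    obtain ⟨z, hz⟩ := exists_between hlu.2
    exact ⟨(csInf_le hbd.bddBelow (hsub ⟨hy.1, hy.2.trans hlu.2⟩)).trans_lt hy.2,
      hz.1.trans_le (le_csSup hbd.bddAbove (hsub ⟨hlu.1.trans hz.1, hz.2⟩))⟩
  set E₀ := sInf G
  set E₁ := sSup G
  have hE' : E ∈ Ioo E₀ E₁ := hIoo ▸ hEG
  have hlt : E₀ < E₁ := hE'.1.trans hE'.2
  have hcl : Icc E₀ E₁ ⊆ {E | 4 ≤ k E ^ 2} := by
    rw [← closure_Ioo hlt.ne, ← hIoo]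
    exact closure_minimal (fun x hx => (show 4 < k x ^ 2 from hGO hx).le)
      (isClosed_le continuous_const (hk.pow 2))
  have hmax : ∀ {I : Set ℝ}, IsPreconnected I → E ∈ I → I ⊆ O → I ⊆ Ioo E₀ E₁ := by
    intro I hI hEI hIsub
    rw [← hIoo, hGE]
    exact hI.subset_connectedComponentIn hEI hIsub
  refine ⟨E₀, E₁, hlt, hIoo, le_antisymm ?_ (hcl ⟨le_rfl, hlt.le⟩),
    le_antisymm ?_ (hcl ⟨hlt.le, le_rfl⟩), fun x hx => hGO hx⟩
  · by_contra! h
    have hsub : Ico E₀ E₁ ⊆ O := by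
      rw [← Ioo_insert_left hlt, ← hIoo]
      exact insert_subset h hGO
    exact lt_irrefl _ (hmax isPreconnected_Ico ⟨hE'.1.le, hE'.2⟩ hsub ⟨le_rfl, hlt⟩).1
  · by_contra! h
    have hsub : Ioc E₀ E₁ ⊆ O := by
      rw [← Ioo_insert_right hlt, ← hIoo]
      exact insert_subset h hGO
    exact lt_irrefl _ (hmax isPreconnected_Ioc ⟨hE'.1, hE'.2.le⟩ hsub ⟨hlt, le_rfl⟩).2

end Gap

/-- **Eigenvalue count in a gap.** Suppose the gap `G` lies in the classically allowed
region for the defect (`E > q_def x` for all `E ∈ closure G`, `x ∈ [0,1]`). With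
`R_def = {E | trace (N E 1) ^ 2 ≥ 4}`, let `n_G` be the number of connected components of
`R_def ∩ G`, `n_∂G` the number of points of `(closure G \ G) ∩ R_def`, and `D` the number
of defect eigenvalues in `G` (all as extended natural numbers). Then
`n_G + 1 - n_∂G ≤ D ≤ n_G + 1`. -/
theorem defect_eigenvalue_count_in_gap
    (a : ℝ) (ha : 0 < a) (q_per q_def : ℝ → ℝ)
    (hperb : ∃ C, ∀ x, |q_per x| ≤ C) (hdefb : ∃ C, ∀ x, |q_def x| ≤ C)
    (hperc : PiecewiseContinuous q_per) (hdefc : PiecewiseContinuous q_def)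
    (hper : ∀ x, q_per (x + a) = q_per x)
    (U N : ℝ → ℝ → Matrix (Fin 2) (Fin 2) ℝ)
    (hU : ∀ E, IsFundamentalSolution q_per E (U E))
    (hN : ∀ E, IsFundamentalSolution q_def E (N E))
    (q : ℝ → ℝ)
    (hq : ∀ x, q x = if x ≤ 0 then q_per x else if x < 1 then q_def x else q_per (x - 1))
    (k : ℝ → ℝ) (hk : ∀ E, k E = (U E a).trace)
    (Rdef : Set ℝ) (hRdef : Rdef = {E : ℝ | (N E 1).trace ^ 2 ≥ 4})
    (G : Set ℝ) (hG : IsGap k G)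
    (hclass : ∀ E ∈ closure G, ∀ x ∈ Set.Icc (0:ℝ) 1, q_def x < E)
    (nG nBd D : ℕ∞)
    (hnG : nG = {C : Set ℝ | ∃ E ∈ Rdef ∩ G, C = connectedComponentIn (Rdef ∩ G) E}.encard)
    (hnBd : nBd = ((closure G \ G) ∩ Rdef).encard)
    (hD : D = {E ∈ G | IsDefectEigenvalue q E}.encard) :
    nG + 1 - nBd ≤ D ∧ D ≤ nG + 1 := by
  obtain ⟨θM, hM⟩ := (isRotating_of_isFundamentalSolution
    (hperc.isRegularPotential hperb) hU ha).exists_angleLift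
  obtain ⟨θN, hNL⟩ := (isRotating_of_isFundamentalSolution
    (hdefc.isRegularPotential hdefb) hN one_pos).exists_angleLift
  have hp := hperc.isRegularPotential hperb
  have hd := hdefc.isRegularPotential hdefb
  have hkc : Continuous k := by
    rw [funext hk]
    simp only [Matrix.trace_fin_two]
    exact (continuous_energy_of_isFundamentalSolution hp hU ha.le 0 0).add
      (continuous_energy_of_isFundamentalSolution hp hU ha.le 1 1)
  obtain ⟨E₀, E₁, hlt, rfl, hk0, hk1, hkG⟩ := hG.exists_eq_Ioo hkc
  simp only [hk] at hk0 hk1 hkG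
  obtain ⟨α, β, hα, hβ, hαm, hβm, h0, h1, heig⟩ := hM.exists_gap_directions hlt hkG hk0 hk1
  obtain ⟨hlow, hupp⟩ := hNL.encard_bounds hlt hα hβ hαm hβm h0 h1
  have hcomp := hNL.encard_components (Set.ordConnected_Ioo (a := E₀) (b := E₁))
  have hDset : {E ∈ Set.Ioo E₀ E₁ | IsDefectEigenvalue q E} =
      {E ∈ Set.Ioo E₀ E₁ | Real.sin (θN E (α E) - β E) = 0} := by
    ext E
    refine and_congr_right fun hE => ?_
    obtain ⟨c, hc, hcα, hcβ⟩ := heig E hE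
    obtain ⟨r, hr, hr0, hr1⟩ := hNL.spec E (α E)
    rw [isDefectEigenvalue_iff_bracket_eq_zero ha hp hd hper (hU E) (hN E) hq hc hcα hcβ, hr0, hr1,
      Real.sin_sub]
    rw [show ∀ s t u v : ℝ, r * s * u - r * t * v = r * (s * u - t * v) by intros; ring,
      mul_eq_zero, or_iff_right hr]
  have hbd : closure (Set.Ioo E₀ E₁) \ Set.Ioo E₀ E₁ = {E₀, E₁} := by
    rw [closure_Ioo hlt.ne, Set.Icc_sdiff_Ioo_same hlt.le]
  rw [hnG, hnBd, hD, hDset, hbd, hRdef]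
  rw [← hcomp] at hlow hupp
  exact ⟨tsub_le_iff_right.2 hlow, hupp⟩
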